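/- arXiv:0704.3110 — 4 statements merged into one kernel-verified Lean document; each statement's English description precedes it below -/
import Mathlib

section
/- Let ε > 0, let h : ℝ → ℝ be C¹, and let ψ : ℝ × ℝ^d → ℂ (time t, space x) be C¹ in t and C³ in x with all mixed derivatives continuous, solving the nonlinear Schrödinger equation iε ψ_t = −(ε²/2) Δψ + h(|ψ|²) ψ pointwise. Define ρ := |ψ|², and on the open set where ψ ≠ 0 define u := ε·Im(conj(ψ)·∇ψ)/|ψ|². Let P : (0,∞) → ℝ be any C¹ function with P'(r) = r·h'(r) for r > 0. Then on the open set where ψ ≠ 0, the pair (ρ, u) satisfies the quantum hydrodynamic equations ρ_t + div(ρu) = 0 and (ρu)_t + div(ρ u⊗u) + ∇P(ρ) = (ε²/2) ρ ∇(Δ√ρ/√ρ). -/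
open Real Set Complex
open scoped BigOperators

/-- Partial derivative in the `j`-th coordinate direction of `ℝ^d`. -/
noncomputable def pd {d : ℕ} {F : Type*} [NormedAddCommGroup F] [NormedSpace ℝ F]
    (j : Fin d) (f : EuclideanSpace ℝ (Fin d) → F) (x : EuclideanSpace ℝ (Fin d)) : F :=
  fderiv ℝ f x (EuclideanSpace.single j 1)

/-- `f` is differentiable at `x`, with partial derivative `f'` in the `j`-th direction. -/
def HasPDerivAt {d : ℕ} (j : Fin d) (f : EuclideanSpace ℝ (Fin d) → ℝ) (f' : ℝ)
    (x : EuclideanSpace ℝ (Fin d)) : Prop :=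
  DifferentiableAt ℝ f x ∧ pd j f x = f'

namespace HasPDerivAt

variable {d : ℕ} {j : Fin d} {f g : EuclideanSpace ℝ (Fin d) → ℝ} {f' g' : ℝ}
  {x : EuclideanSpace ℝ (Fin d)}

lemma of_hasFDerivAt {L : EuclideanSpace ℝ (Fin d) →L[ℝ] ℝ} (hf : HasFDerivAt f L x)
    (hL : L (EuclideanSpace.single j 1) = f') : HasPDerivAt j f f' x :=
  ⟨hf.differentiableAt, by rw [pd, hf.fderiv, hL]⟩

lemma congr_deriv (hf : HasPDerivAt j f f' x) (h : f' = g') : HasPDerivAt j f g' x :=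
  h ▸ hf

lemma congr_of_eventuallyEq (hf : HasPDerivAt j f f' x) (h : g =ᶠ[nhds x] f) :
    HasPDerivAt j g f' x :=
  ⟨hf.1.congr_of_eventuallyEq h, by rw [pd, h.fderiv_eq]; exact hf.2⟩

lemma add (hf : HasPDerivAt j f f' x) (hg : HasPDerivAt j g g' x) :
    HasPDerivAt j (fun y => f y + g y) (f' + g') x :=
  of_hasFDerivAt (hf.1.hasFDerivAt.add hg.1.hasFDerivAt) (by
    simpa [pd] using congrArg₂ (· + ·) hf.2 hg.2)

lemma sub (hf : HasPDerivAt j f f' x) (hg : HasPDerivAt j g g' x) :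
    HasPDerivAt j (fun y => f y - g y) (f' - g') x :=
  of_hasFDerivAt (hf.1.hasFDerivAt.sub hg.1.hasFDerivAt) (by
    simpa [pd] using congrArg₂ (· - ·) hf.2 hg.2)

lemma mul (hf : HasPDerivAt j f f' x) (hg : HasPDerivAt j g g' x) :
    HasPDerivAt j (fun y => f y * g y) (f' * g x + f x * g') x :=
  of_hasFDerivAt (hf.1.hasFDerivAt.mul hg.1.hasFDerivAt) (by
    have h₁ := hf.2
    have h₂ := hg.2
    simp only [pd] at h₁ h₂
    simp [h₁, h₂]
    ring)

lemma comp {φ : ℝ → ℝ} {φ' : ℝ} (hf : HasPDerivAt j f f' x) (hφ : HasDerivAt φ φ' (f x)) :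
    HasPDerivAt j (fun y => φ (f y)) (φ' * f') x :=
  of_hasFDerivAt (hφ.comp_hasFDerivAt x hf.1.hasFDerivAt) (by
    have h₁ := hf.2
    simp only [pd] at h₁
    simp [h₁])

lemma const_mul (c : ℝ) (hf : HasPDerivAt j f f' x) :
    HasPDerivAt j (fun y => c * f y) (c * f') x :=
  hf.comp (φ := fun r => c * r) (by simpa using (hasDerivAt_id (f x)).const_mul c)

lemma inv (hf : HasPDerivAt j f f' x) (h0 : f x ≠ 0) :
    HasPDerivAt j (fun y => (f y)⁻¹) (-(f' / f x ^ 2)) x :=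
  (hf.comp (hasDerivAt_inv h0)).congr_deriv (by field_simp)

lemma div (hf : HasPDerivAt j f f' x) (hg : HasPDerivAt j g g' x) (h0 : g x ≠ 0) :
    HasPDerivAt j (fun y => f y / g y) ((f' * g x - f x * g') / g x ^ 2) x := by
  simp only [div_eq_mul_inv (f _)]
  exact (hf.mul (hg.inv h0)).congr_deriv (by field_simp; ring)

lemma sum {ι : Type*} {s : Finset ι} {f : ι → EuclideanSpace ℝ (Fin d) → ℝ} {f' : ι → ℝ}
    (hf : ∀ k ∈ s, HasPDerivAt j (f k) (f' k) x) :
    HasPDerivAt j (fun y => ∑ k ∈ s, f k y) (∑ k ∈ s, f' k) x :=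
  of_hasFDerivAt (HasFDerivAt.fun_sum fun k hk => (hf k hk).1.hasFDerivAt) (by
    simp only [_root_.sum_apply]
    exact Finset.sum_congr rfl fun k hk => (hf k hk).2)

lemma hasDerivAt_line (hf : HasPDerivAt j f f' x) {y : EuclideanSpace ℝ (Fin d)} {r : ℝ}
    (hx : y + r • EuclideanSpace.single j (1 : ℝ) = x) :
    HasDerivAt (fun r : ℝ => f (y + r • EuclideanSpace.single j (1 : ℝ))) f' r := by
  subst hx
  have h₁ := hf.1.hasFDerivAt.comp_hasDerivAt r
    (((hasDerivAt_id r).smul_const (EuclideanSpace.single j (1 : ℝ))).const_add y)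
  have h₂ := hf.2
  rw [pd] at h₂
  simpa [Function.comp_def, h₂] using h₁

end HasPDerivAt

section PartialDerivatives

variable {d : ℕ} {F : Type*} [NormedAddCommGroup F] [NormedSpace ℝ F]

lemma DifferentiableAt.hasPDerivAt {f : EuclideanSpace ℝ (Fin d) → ℝ}
    {x : EuclideanSpace ℝ (Fin d)} (hf : DifferentiableAt ℝ f x) (j : Fin d) :
    HasPDerivAt j f (pd j f x) x :=
  ⟨hf, rfl⟩

lemma ContDiff.pd {f : EuclideanSpace ℝ (Fin d) → F} {m n : WithTop ℕ∞} (hf : ContDiff ℝ n f)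
    (hmn : m + 1 ≤ n) (j : Fin d) : ContDiff ℝ m (pd j f) :=
  (hf.fderiv_right hmn).clm_apply contDiff_const

lemma pd_clm_comp {G : Type*} [NormedAddCommGroup G] [NormedSpace ℝ G] (L : F →L[ℝ] G)
    {f : EuclideanSpace ℝ (Fin d) → F} (hf : Differentiable ℝ f) (j : Fin d) :
    pd j (fun y => L (f y)) = fun y => L (pd j f y) := by
  funext x
  have h := L.hasFDerivAt.comp x (hf x).hasFDerivAt
  simp only [pd]
  rw [show (fun y => L (f y)) = L ∘ f from rfl, h.fderiv]
  rfl

lemma pd_comm {f : EuclideanSpace ℝ (Fin d) → F} (hf : ContDiff ℝ 2 f) (i j : Fin d)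
    (x : EuclideanSpace ℝ (Fin d)) : pd i (pd j f) x = pd j (pd i f) x := by
  have key : ∀ k l : Fin d, pd k (pd l f) x =
      fderiv ℝ (fderiv ℝ f) x (EuclideanSpace.single k 1) (EuclideanSpace.single l 1) := by
    intro k l
    have h : DifferentiableAt ℝ (fderiv ℝ f) x :=
      ((hf.fderiv_right (m := 1) (by norm_num)).differentiable (by norm_num)) x
    have := h.hasFDerivAt.clm_apply
      (hasFDerivAt_const (EuclideanSpace.single l (1 : ℝ) : EuclideanSpace ℝ (Fin d)) x)
    change fderiv ℝ (fun y => fderiv ℝ f y (EuclideanSpace.single l 1)) x _ = _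
    rw [this.fderiv]
    simp
  rw [key, key]
  exact (hf.contDiffAt.isSymmSndFDerivAt (by simp)) _ _

end PartialDerivatives

/-- Exchange of a time derivative and a space derivative, when the space derivative of the time
derivative is jointly continuous. -/
lemma hasDerivAt_deriv_swap {f ft fr ftr : ℝ → ℝ → ℝ} {t r : ℝ}
    (hft : ∀ s q, HasDerivAt (fun s => f s q) (ft s q) s)
    (hfr : ∀ s, HasDerivAt (f s) (fr s r) r)
    (hftr : ∀ s q, HasDerivAt (ft s) (ftr s q) q)
    (hc : ContinuousAt (fun p : ℝ × ℝ => ftr p.1 p.2) (t, r)) :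
    HasDerivAt (fun s => fr s r) (ftr t r) t := by
  rw [hasDerivAt_iff_isLittleO, Asymptotics.isLittleO_iff]
  intro c hcpos
  obtain ⟨δ, hδ, hb⟩ := Metric.continuousAt_iff.1 hc c hcpos
  filter_upwards [Metric.ball_mem_nhds t hδ] with s hs
  have hball : ∀ s' ∈ Metric.ball t δ, ∀ q ∈ Metric.ball r δ, ‖ftr s' q - ftr t r‖ ≤ c := by
    intro s' hs' q hq
    have := hb (x := (s', q)) (by
      rw [Prod.dist_eq]
      exact max_lt hs' hq)
    exact (by simpa [Real.dist_eq] using this.le)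
  have hquot : ∀ q ∈ Metric.ball r δ,
      ‖(f s q - f t q) - (f s r - f t r) - (s - t) * ((q - r) * ftr t r)‖
        ≤ c * ‖s - t‖ * ‖q - r‖ := by
    intro q hq
    have hinner : ∀ s' ∈ Metric.ball t δ,
        ‖ft s' q - ft s' r - (q - r) * ftr t r‖ ≤ c * ‖q - r‖ := by
      intro s' hs'
      have := (convex_ball r δ).norm_image_sub_le_of_norm_hasDerivWithin_le
        (f := fun q => ft s' q - q * ftr t r) (f' := fun q => ftr s' q - ftr t r)
        (fun p _ => ((hftr s' p).sub (by
          simpa using (hasDerivAt_id p).mul_const (ftr t r))).hasDerivWithinAt)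
        (fun p hp => hball s' hs' p hp) (Metric.mem_ball_self hδ) hq
      calc _ = _ := by congr 1; ring
        _ ≤ _ := this
    have := (convex_ball t δ).norm_image_sub_le_of_norm_hasDerivWithin_le
      (f := fun s' => f s' q - f s' r - s' * ((q - r) * ftr t r))
      (f' := fun s' => ft s' q - ft s' r - (q - r) * ftr t r)
      (fun p _ => (((hft p q).sub (hft p r)).sub (by
        simpa using (hasDerivAt_id p).mul_const ((q - r) * ftr t r))).hasDerivWithinAt)
      hinner (Metric.mem_ball_self hδ) hs
    calc _ = _ := by congr 1; ring
      _ ≤ _ := this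
      _ = _ := by ring
  have hlim : HasDerivAt (fun q => (f s q - f t q) - (s - t) * (q * ftr t r))
      (fr s r - fr t r - (s - t) * ftr t r) r :=
    ((hfr s).sub (hfr t)).sub
      (by simpa using ((hasDerivAt_id r).mul_const (ftr t r)).const_mul (s - t))
  refine (hlim.le_of_lip' (C := c * ‖s - t‖) (by positivity) ?_)
  filter_upwards [Metric.ball_mem_nhds r hδ] with q hq
  calc _ = _ := by congr 1; ring
    _ ≤ _ := hquot q hq

lemma hasDerivAt_pd {d : ℕ} {φ φt : ℝ → EuclideanSpace ℝ (Fin d) → ℝ} {j : Fin d}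
    (hφt : ∀ s y, HasDerivAt (fun s => φ s y) (φt s y) s)
    (hφ : ∀ s, Differentiable ℝ (φ s)) {φtj : ℝ → EuclideanSpace ℝ (Fin d) → ℝ}
    (hφtj : ∀ s y, HasPDerivAt j (φt s) (φtj s y) y)
    (hc : Continuous fun p : ℝ × EuclideanSpace ℝ (Fin d) => φtj p.1 p.2)
    (t : ℝ) (x : EuclideanSpace ℝ (Fin d)) :
    HasDerivAt (fun s => pd j (φ s) x) (φtj t x) t := by
  have := hasDerivAt_deriv_swap (r := 0) (t := t)
    (f := fun s q => φ s (x + q • EuclideanSpace.single j (1 : ℝ)))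
    (ft := fun s q => φt s (x + q • EuclideanSpace.single j (1 : ℝ)))
    (fr := fun s _ => pd j (φ s) x)
    (ftr := fun s q => φtj s (x + q • EuclideanSpace.single j (1 : ℝ)))
    (fun s q => hφt s _)
    (fun s => ((hφ s x).hasPDerivAt j).hasDerivAt_line (by simp))
    (fun s q => (hφtj s _).hasDerivAt_line rfl)
    (hc.comp (by fun_prop : Continuous fun p : ℝ × ℝ =>
      (p.1, x + p.2 • EuclideanSpace.single j (1 : ℝ)))).continuousAt
  simpa using this

section Madelung

variable {d : ℕ}

lemma pd_pd_sqrt_div_sqrt {ρ : EuclideanSpace ℝ (Fin d) → ℝ} (hρ : ContDiff ℝ 2 ρ)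
    {y : EuclideanSpace ℝ (Fin d)} (hy : 0 < ρ y) (j : Fin d) :
    pd j (pd j (fun z => √(ρ z))) y / √(ρ y) =
      pd j (pd j ρ) y / (2 * ρ y) - pd j ρ y ^ 2 / (4 * ρ y ^ 2) := by
  have hd : Differentiable ℝ ρ := hρ.differentiable (by norm_num)
  have hdj : Differentiable ℝ (pd j ρ) :=
    (hρ.pd (m := 1) (by norm_num) j).differentiable (by norm_num)
  have hsqrt : ∀ z, 0 < ρ z →
      HasPDerivAt j (fun z => √(ρ z)) (1 / (2 * √(ρ z)) * pd j ρ z) z := fun z hz =>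
    ((hd z).hasPDerivAt j).comp (Real.hasDerivAt_sqrt hz.ne')
  have hev : pd j (fun z => √(ρ z)) =ᶠ[nhds y] fun z => pd j ρ z / (2 * √(ρ z)) := by
    filter_upwards [hd.continuous.continuousAt.eventually (lt_mem_nhds hy)] with z hz
    rw [(hsqrt z hz).2]
    ring
  have hs : 0 < √(ρ y) := Real.sqrt_pos.2 hy
  have key := (((hdj y).hasPDerivAt j).div ((hsqrt y hy).const_mul 2)
    (by positivity)).congr_of_eventuallyEq hev
  rw [key.2]
  have h2 : ρ y = √(ρ y) ^ 2 := (Real.sq_sqrt hy.le).symm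
  generalize √(ρ y) = s at *
  rw [h2]
  field_simp
  ring

/-- The gradient of the Bohm potential `Δ√ρ/√ρ` in terms of the derivatives of `ρ`. -/
lemma hasPDerivAt_bohm {ρ : EuclideanSpace ℝ (Fin d) → ℝ} (hρ : ContDiff ℝ 3 ρ)
    {x : EuclideanSpace ℝ (Fin d)} (hx : 0 < ρ x) (i : Fin d) :
    HasPDerivAt i (fun y => (∑ j : Fin d, pd j (pd j (fun z => √(ρ z))) y) / √(ρ y))
      (∑ j : Fin d, (pd i (pd j (pd j ρ)) x / (2 * ρ x)
        - pd j (pd j ρ) x * pd i ρ x / (2 * ρ x ^ 2)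
        - pd j ρ x * pd i (pd j ρ) x / (2 * ρ x ^ 2)
        + pd j ρ x ^ 2 * pd i ρ x / (2 * ρ x ^ 3))) x := by
  have hd : Differentiable ℝ ρ := hρ.differentiable (by norm_num)
  have h1 : ∀ j, ContDiff ℝ 2 (pd j ρ) := fun j => hρ.pd (by norm_num) j
  have h2 : ∀ j, ContDiff ℝ 1 (pd j (pd j ρ)) := fun j => (h1 j).pd (by norm_num) j
  have hev : (fun y => (∑ j : Fin d, pd j (pd j (fun z => √(ρ z))) y) / √(ρ y)) =ᶠ[nhds x]
      fun y => ∑ j : Fin d, (pd j (pd j ρ) y / (2 * ρ y)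
        - pd j ρ y * pd j ρ y / (4 * (ρ y * ρ y))) := by
    filter_upwards [hd.continuous.continuousAt.eventually (lt_mem_nhds hx)] with y hy
    rw [Finset.sum_div]
    refine Finset.sum_congr rfl fun j _ => ?_
    rw [pd_pd_sqrt_div_sqrt (hρ.of_le (by norm_num)) hy, sq, sq]
  refine (HasPDerivAt.sum fun j _ => ?_).congr_of_eventuallyEq hev
  have D0 := (hd x).hasPDerivAt i
  have D1 := ((h1 j).differentiable (by norm_num) x).hasPDerivAt i
  have D2 := ((h2 j).differentiable (by norm_num) x).hasPDerivAt i
  refine ((D2.div (D0.const_mul 2) (by positivity)).sub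
    ((D1.mul D1).div ((D0.mul D0).const_mul 4) (by positivity))).congr_deriv ?_
  field_simp
  ring

variable {a b : EuclideanSpace ℝ (Fin d) → ℝ}

lemma hasPDerivAt_sq_add_sq {x : EuclideanSpace ℝ (Fin d)} (ha : DifferentiableAt ℝ a x)
    (hb : DifferentiableAt ℝ b x) (j : Fin d) :
    HasPDerivAt j (fun y => a y ^ 2 + b y ^ 2) (2 * (a x * pd j a x + b x * pd j b x)) x := by
  simp only [sq]
  have Da := ha.hasPDerivAt j
  have Db := hb.hasPDerivAt j
  exact ((Da.mul Da).add (Db.mul Db)).congr_deriv (by ring)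

lemma pd_sq_add_sq (ha : Differentiable ℝ a) (hb : Differentiable ℝ b) (j : Fin d) :
    pd j (fun y => a y ^ 2 + b y ^ 2) = fun y => 2 * (a y * pd j a y + b y * pd j b y) :=
  funext fun y => (hasPDerivAt_sq_add_sq (ha y) (hb y) j).2

lemma hasPDerivAt_pd_sq_add_sq (ha : ContDiff ℝ 2 a) (hb : ContDiff ℝ 2 b) (i j : Fin d)
    (x : EuclideanSpace ℝ (Fin d)) :
    HasPDerivAt i (pd j (fun y => a y ^ 2 + b y ^ 2))
      (2 * (pd i a x * pd j a x + a x * pd i (pd j a) x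
        + (pd i b x * pd j b x + b x * pd i (pd j b) x))) x := by
  have hda := ha.differentiable (by norm_num)
  have hdb := hb.differentiable (by norm_num)
  rw [pd_sq_add_sq hda hdb]
  have Daj := ((ha.pd (m := 1) (by norm_num) j).differentiable (by norm_num) x).hasPDerivAt i
  have Dbj := ((hb.pd (m := 1) (by norm_num) j).differentiable (by norm_num) x).hasPDerivAt i
  exact (((hda x).hasPDerivAt i).mul Daj |>.add (((hdb x).hasPDerivAt i).mul Dbj)).const_mul 2

lemma hasPDerivAt_pd_pd_sq_add_sq (ha : ContDiff ℝ 3 a) (hb : ContDiff ℝ 3 b) (i j : Fin d)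
    (x : EuclideanSpace ℝ (Fin d)) :
    HasPDerivAt i (pd j (pd j (fun y => a y ^ 2 + b y ^ 2)))
      (2 * (2 * pd j a x * pd i (pd j a) x + pd i a x * pd j (pd j a) x
          + a x * pd i (pd j (pd j a)) x
        + (2 * pd j b x * pd i (pd j b) x + pd i b x * pd j (pd j b) x
          + b x * pd i (pd j (pd j b)) x))) x := by
  have hda := ha.differentiable (by norm_num)
  have hdb := hb.differentiable (by norm_num)
  have ha1 := ha.pd (m := 2) (by norm_num) j
  have hb1 := hb.pd (m := 2) (by norm_num) j
  have Da := (hda x).hasPDerivAt i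
  have Db := (hdb x).hasPDerivAt i
  have Daj := (ha1.differentiable (by norm_num) x).hasPDerivAt i
  have Dbj := (hb1.differentiable (by norm_num) x).hasPDerivAt i
  have Dajj := ((ha1.pd (m := 1) (by norm_num) j).differentiable (by norm_num) x).hasPDerivAt i
  have Dbjj := ((hb1.pd (m := 1) (by norm_num) j).differentiable (by norm_num) x).hasPDerivAt i
  rw [show pd j (pd j (fun y => a y ^ 2 + b y ^ 2)) = _ from
    funext fun y => (hasPDerivAt_pd_sq_add_sq (ha.of_le (by norm_num)) (hb.of_le (by norm_num))
      j j y).2]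
  exact ((((Daj.mul Daj).add (Da.mul Dajj)).add
    ((Dbj.mul Dbj).add (Db.mul Dbjj))).const_mul 2).congr_deriv (by ring)

lemma hasPDerivAt_current (ha : ContDiff ℝ 2 a) (hb : ContDiff ℝ 2 b) (i j : Fin d)
    (x : EuclideanSpace ℝ (Fin d)) :
    HasPDerivAt j (fun y => a y * pd i b y - b y * pd i a y)
      (pd j a x * pd i b x + a x * pd j (pd i b) x
        - (pd j b x * pd i a x + b x * pd j (pd i a) x)) x := by
  have hda := ha.differentiable (by norm_num)
  have hdb := hb.differentiable (by norm_num)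
  have Dai := ((ha.pd (m := 1) (by norm_num) i).differentiable (by norm_num) x).hasPDerivAt j
  have Dbi := ((hb.pd (m := 1) (by norm_num) i).differentiable (by norm_num) x).hasPDerivAt j
  exact (((hda x).hasPDerivAt j).mul Dbi).sub (((hdb x).hasPDerivAt j).mul Dai)

/-- The convective flux of the Madelung fluid, combined with the linear part of the evolution of
the momentum, is the Bohm force. -/
lemma pd_flux_add_eq_bohm (ha : ContDiff ℝ 3 a) (hb : ContDiff ℝ 3 b)
    {x : EuclideanSpace ℝ (Fin d)} (hx : 0 < a x ^ 2 + b x ^ 2) (i : Fin d) :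
    (∑ j : Fin d, pd j (fun y => (a y * pd i b y - b y * pd i a y)
          * (a y * pd j b y - b y * pd j a y) / (a y ^ 2 + b y ^ 2)) x)
      + 1 / 2 * (a x * (∑ j : Fin d, pd i (pd j (pd j a)) x)
        + b x * (∑ j : Fin d, pd i (pd j (pd j b)) x)
        - (∑ j : Fin d, pd j (pd j a) x) * pd i a x
        - (∑ j : Fin d, pd j (pd j b) x) * pd i b x)
      = 1 / 2 * (a x ^ 2 + b x ^ 2)
        * pd i (fun y => (∑ j : Fin d, pd j (pd j (fun z => √(a z ^ 2 + b z ^ 2))) y)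
            / √(a y ^ 2 + b y ^ 2)) x := by
  have ha2 : ContDiff ℝ 2 a := ha.of_le (by norm_num)
  have hb2 : ContDiff ℝ 2 b := hb.of_le (by norm_num)
  have hda := ha.differentiable (by norm_num)
  have hdb := hb.differentiable (by norm_num)
  rw [(hasPDerivAt_bohm (ρ := fun y => a y ^ 2 + b y ^ 2) ((ha.pow 2).add (hb.pow 2)) hx i).2]
  simp only [Finset.mul_sum, Finset.sum_mul, ← Finset.sum_add_distrib, ← Finset.sum_sub_distrib]
  refine Finset.sum_congr rfl fun j _ => ?_
  rw [(((hasPDerivAt_current ha2 hb2 i j x).mul (hasPDerivAt_current ha2 hb2 j j x)).div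
    (hasPDerivAt_sq_add_sq (hda x) (hdb x) j) hx.ne').2,
    (hasPDerivAt_pd_pd_sq_add_sq ha hb i j x).2, (hasPDerivAt_pd_sq_add_sq ha2 hb2 i j x).2,
    (hasPDerivAt_pd_sq_add_sq ha2 hb2 j j x).2, pd_sq_add_sq hda hdb i, pd_sq_add_sq hda hdb j,
    pd_comm ha2 j i, pd_comm hb2 j i]
  have hx' := hx.ne'
  field_simp
  ring

lemma density_deriv_add_div_current (ha : ContDiff ℝ 2 a) (hb : ContDiff ℝ 2 b) (ε H : ℝ) (hε : ε ≠ 0)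
    (x : EuclideanSpace ℝ (Fin d)) :
    2 * (a x * (-(ε / 2) * (∑ j : Fin d, pd j (pd j b) x) + H / ε * b x)
        + b x * (ε / 2 * (∑ j : Fin d, pd j (pd j a) x) - H / ε * a x))
      + ∑ j : Fin d, pd j (fun y => ε * (a y * pd j b y - b y * pd j a y)) x = 0 := by
  have : ∀ j : Fin d, pd j (fun y => ε * (a y * pd j b y - b y * pd j a y)) x
      = ε * (a x * pd j (pd j b) x) - ε * (b x * pd j (pd j a) x) := fun j => by
    rw [((hasPDerivAt_current ha hb j j x).const_mul ε).2]
    ring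
  simp only [this, Finset.sum_sub_distrib, ← Finset.mul_sum]
  field_simp
  ring

end Madelung

/-- Time derivative of a spatial derivative of one of the two components of a solution of a
Schrödinger equation. -/
lemma hasDerivAt_pd_of_schroedinger {d : ℕ} {h : ℝ → ℝ} (hh : ContDiff ℝ 1 h)
    {a b f : ℝ → EuclideanSpace ℝ (Fin d) → ℝ} {c k : ℝ} {i : Fin d}
    (ha : ∀ t, ContDiff ℝ 3 (a t)) (hb : ∀ t, ContDiff ℝ 3 (b t))
    (hf : ∀ t, ContDiff ℝ 3 (f t))
    (hca : Continuous fun p : ℝ × EuclideanSpace ℝ (Fin d) => a p.1 p.2)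
    (hcb : Continuous fun p : ℝ × EuclideanSpace ℝ (Fin d) => b p.1 p.2)
    (hcf : Continuous fun p : ℝ × EuclideanSpace ℝ (Fin d) => f p.1 p.2)
    (hca1 : Continuous fun p : ℝ × EuclideanSpace ℝ (Fin d) => pd i (a p.1) p.2)
    (hcb1 : Continuous fun p : ℝ × EuclideanSpace ℝ (Fin d) => pd i (b p.1) p.2)
    (hcf1 : Continuous fun p : ℝ × EuclideanSpace ℝ (Fin d) => pd i (f p.1) p.2)
    (hcf3 : ∀ j, Continuous fun p : ℝ × EuclideanSpace ℝ (Fin d) =>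
      pd i (pd j (pd j (f p.1))) p.2)
    {g : ℝ → EuclideanSpace ℝ (Fin d) → ℝ} (hg : ∀ t, Differentiable ℝ (g t))
    (hgt : ∀ t x, HasDerivAt (fun s => g s x) (c * (∑ j : Fin d, pd j (pd j (f t)) x)
      + k * (h (a t x ^ 2 + b t x ^ 2) * f t x)) t)
    (t : ℝ) (x : EuclideanSpace ℝ (Fin d)) :
    HasDerivAt (fun s => pd i (g s) x) (c * (∑ j : Fin d, pd i (pd j (pd j (f t))) x)
      + k * (deriv h (a t x ^ 2 + b t x ^ 2)
          * (2 * (a t x * pd i (a t) x + b t x * pd i (b t) x)) * f t x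
        + h (a t x ^ 2 + b t x ^ 2) * pd i (f t) x)) t := by
  refine hasDerivAt_pd hgt hg (φtj := fun t x => c * (∑ j : Fin d, pd i (pd j (pd j (f t))) x)
      + k * (deriv h (a t x ^ 2 + b t x ^ 2)
          * (2 * (a t x * pd i (a t) x + b t x * pd i (b t) x)) * f t x
        + h (a t x ^ 2 + b t x ^ 2) * pd i (f t) x)) (fun s y => ?_) ?_ t x
  · have hD : ∀ j, HasPDerivAt i (pd j (pd j (f s))) (pd i (pd j (pd j (f s))) y) y := fun j =>
      ((((hf s).pd (m := 2) (by norm_num) j).pd (m := 1) (by norm_num) j).differentiable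
        (by norm_num) y).hasPDerivAt i
    have hd : ∀ {F : ℝ → EuclideanSpace ℝ (Fin d) → ℝ}, (∀ t, ContDiff ℝ 3 (F t)) →
        DifferentiableAt ℝ (F s) y := fun hF => (hF s).differentiable (by norm_num) y
    have hH := (hasPDerivAt_sq_add_sq (hd ha) (hd hb) i).comp
      ((hh.differentiable (by norm_num)) (a s y ^ 2 + b s y ^ 2)).hasDerivAt
    exact ((HasPDerivAt.sum fun j _ => hD j).const_mul c).add
      ((hH.mul ((hd hf).hasPDerivAt i)).const_mul k)
  · have hh0 : Continuous h := hh.continuous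
    have hh1 : Continuous (deriv h) := hh.continuous_deriv (by norm_num)
    have hcs := continuous_finsetSum Finset.univ fun j _ => hcf3 j
    fun_prop

/-- Madelung transform: a nowhere-degenerate solution `ψ` of the nonlinear Schrödinger
equation `iεψ_t = −(ε²/2)Δψ + h(|ψ|²)ψ` yields, on the open set where `ψ ≠ 0`, a solution
`(ρ, u)` with `ρ = |ψ|²` and `u = ε·Im(ψ̄∇ψ)/|ψ|²` of the quantum hydrodynamic system
`ρ_t + div(ρu) = 0`,
`(ρu)_t + div(ρu⊗u) + ∇P(ρ) = (ε²/2) ρ∇(Δ√ρ/√ρ)`, where `P'(r) = r·h'(r)`. -/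
theorem madelung_schroedinger_to_qhd
    (d : ℕ) (ε : ℝ) (hε : 0 < ε)
    (h : ℝ → ℝ) (hh : ContDiff ℝ 1 h)
    (P : ℝ → ℝ) (hP : ContDiffOn ℝ 1 P (Set.Ioi 0))
    (hP' : ∀ r > (0:ℝ), deriv P r = r * deriv h r)
    (ψ : ℝ → EuclideanSpace ℝ (Fin d) → ℂ)
    -- ψ is C¹ in t and C³ in x
    (hψt : ∀ x, ContDiff ℝ 1 (fun t => ψ t x))
    (hψx : ∀ t, ContDiff ℝ 3 (fun x => ψ t x))
    -- all (mixed) derivatives are jointly continuous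
    (hc0 : Continuous fun p : ℝ × EuclideanSpace ℝ (Fin d) => ψ p.1 p.2)
    (hc1 : Continuous fun p : ℝ × EuclideanSpace ℝ (Fin d) => deriv (fun s => ψ s p.2) p.1)
    (hc2 : ∀ j, Continuous fun p : ℝ × EuclideanSpace ℝ (Fin d) => pd j (ψ p.1) p.2)
    (hc3 : ∀ i j, Continuous fun p : ℝ × EuclideanSpace ℝ (Fin d) => pd i (pd j (ψ p.1)) p.2)
    (hc4 : ∀ i j k, Continuous fun p : ℝ × EuclideanSpace ℝ (Fin d) =>
      pd i (pd j (pd k (ψ p.1))) p.2)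
    (hc5 : ∀ j, Continuous fun p : ℝ × EuclideanSpace ℝ (Fin d) =>
      deriv (fun s => pd j (ψ s) p.2) p.1)
    -- ψ solves the nonlinear Schrödinger equation pointwise
    (hNLS : ∀ t : ℝ, ∀ x : EuclideanSpace ℝ (Fin d),
      Complex.I * (ε : ℂ) * deriv (fun s => ψ s x) t
        = -((ε : ℂ) ^ 2 / 2) * (∑ j : Fin d, pd j (pd j (ψ t)) x)
          + (h (Complex.normSq (ψ t x)) : ℂ) * ψ t x)
    -- the hydrodynamic variables
    (ρ : ℝ → EuclideanSpace ℝ (Fin d) → ℝ)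
    (hρ : ∀ t x, ρ t x = Complex.normSq (ψ t x))
    (u : ℝ → EuclideanSpace ℝ (Fin d) → Fin d → ℝ)
    (hu : ∀ t x, ψ t x ≠ 0 → ∀ j : Fin d,
      u t x j = ε * ((starRingEnd ℂ) (ψ t x) * pd j (ψ t) x).im / Complex.normSq (ψ t x)) :
    ∀ t : ℝ, ∀ x : EuclideanSpace ℝ (Fin d), ψ t x ≠ 0 →
      -- continuity equation
      (deriv (fun s => ρ s x) t + ∑ j : Fin d, pd j (fun y => ρ t y * u t y j) x = 0) ∧
      -- momentum balance equation
      (∀ i : Fin d,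
        deriv (fun s => ρ s x * u s x i) t
          + (∑ j : Fin d, pd j (fun y => ρ t y * u t y i * u t y j) x)
          + pd i (fun y => P (ρ t y)) x
        = (ε ^ 2 / 2) * ρ t x
            * pd i (fun y =>
                (∑ j : Fin d, pd j (pd j (fun z => Real.sqrt (ρ t z))) y)
                  / Real.sqrt (ρ t y)) x) := by
  intro t x hx
  set a : ℝ → EuclideanSpace ℝ (Fin d) → ℝ := fun t x => (ψ t x).re with ha_def
  set b : ℝ → EuclideanSpace ℝ (Fin d) → ℝ := fun t x => (ψ t x).im with hb_def
  have hψd : ∀ t, Differentiable ℝ (ψ t) := fun t => (hψx t).differentiable (by norm_num)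
  have hψ1 : ∀ t j, ContDiff ℝ 2 (pd j (ψ t)) := fun t j => (hψx t).pd (by norm_num) j
  have hψ2 : ∀ t i j, ContDiff ℝ 1 (pd i (pd j (ψ t))) := fun t i j => (hψ1 t j).pd (by norm_num) i
  have ha : ∀ t, ContDiff ℝ 3 (a t) := fun t => Complex.reCLM.contDiff.comp (hψx t)
  have hb : ∀ t, ContDiff ℝ 3 (b t) := fun t => Complex.imCLM.contDiff.comp (hψx t)
  have ha2 : ∀ t, ContDiff ℝ 2 (a t) := fun t => (ha t).of_le (by norm_num)
  have hb2 : ∀ t, ContDiff ℝ 2 (b t) := fun t => (hb t).of_le (by norm_num)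
  have hda : ∀ t, Differentiable ℝ (a t) := fun t => (ha t).differentiable (by norm_num)
  have hdb : ∀ t, Differentiable ℝ (b t) := fun t => (hb t).differentiable (by norm_num)
  have ha1 : ∀ t j, pd j (a t) = fun y => (pd j (ψ t) y).re := fun t j =>
    pd_clm_comp Complex.reCLM (hψd t) j
  have hb1 : ∀ t j, pd j (b t) = fun y => (pd j (ψ t) y).im := fun t j =>
    pd_clm_comp Complex.imCLM (hψd t) j
  have ha11 : ∀ t i j, pd i (pd j (a t)) = fun y => (pd i (pd j (ψ t)) y).re := fun t i j => by
    rw [ha1]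
    exact pd_clm_comp Complex.reCLM ((hψ1 t j).differentiable (by norm_num)) i
  have hb11 : ∀ t i j, pd i (pd j (b t)) = fun y => (pd i (pd j (ψ t)) y).im := fun t i j => by
    rw [hb1]
    exact pd_clm_comp Complex.imCLM ((hψ1 t j).differentiable (by norm_num)) i
  have ha111 : ∀ t i j k, pd i (pd j (pd k (a t))) = fun y => (pd i (pd j (pd k (ψ t))) y).re :=
    fun t i j k => by
      rw [ha11]
      exact pd_clm_comp Complex.reCLM ((hψ2 t j k).differentiable (by norm_num)) i
  have hb111 : ∀ t i j k, pd i (pd j (pd k (b t))) = fun y => (pd i (pd j (pd k (ψ t))) y).im :=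
    fun t i j k => by
      rw [hb11]
      exact pd_clm_comp Complex.imCLM ((hψ2 t j k).differentiable (by norm_num)) i
  have hns : ∀ t x, Complex.normSq (ψ t x) = a t x ^ 2 + b t x ^ 2 := fun t x => by
    rw [Complex.normSq_apply, ha_def, hb_def]
    ring
  have hρ' : ρ = fun t x => a t x ^ 2 + b t x ^ 2 := by
    funext t x
    rw [hρ, hns]
  have hpos : ∀ t x, ψ t x ≠ 0 → 0 < a t x ^ 2 + b t x ^ 2 := fun t x h0 => by
    rw [← hns]
    exact Complex.normSq_pos.2 h0
  have hflux : ∀ t x, ψ t x ≠ 0 → ∀ j,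
      ρ t x * u t x j = ε * (a t x * pd j (b t) x - b t x * pd j (a t) x) := by
    intro t x h0 j
    have h1 := (hpos t x h0).ne'
    rw [hρ', hu t x h0 j, hns, ha1, hb1]
    simp only [Complex.mul_im, Complex.conj_re, Complex.conj_im]
    change _ * (ε * (a t x * _ + -b t x * _) / _) = _
    field_simp
    ring
  have hflux2 : ∀ t x, ψ t x ≠ 0 → ∀ i j, ρ t x * u t x i * u t x j =
      ε ^ 2 * ((a t x * pd i (b t) x - b t x * pd i (a t) x)
        * (a t x * pd j (b t) x - b t x * pd j (a t) x) / (a t x ^ 2 + b t x ^ 2)) := by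
    intro t x h0 i j
    have h1 := (hpos t x h0).ne'
    have h2 : ρ t x = a t x ^ 2 + b t x ^ 2 := by rw [hρ']
    have e : ρ t x * u t x i * u t x j = (ρ t x * u t x i) * (ρ t x * u t x j) / ρ t x := by
      rw [← h2] at h1
      field_simp
    rw [e, hflux t x h0, hflux t x h0, h2]
    ring
  have hψt' : ∀ t x, HasDerivAt (fun s => ψ s x) (deriv (fun s => ψ s x) t) t := fun t x =>
    ((hψt x).differentiable (by norm_num) t).hasDerivAt
  have hat : ∀ t x, HasDerivAt (fun s => a s x) (-(ε / 2) * (∑ j : Fin d, pd j (pd j (b t)) x)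
      + 1 / ε * (h (a t x ^ 2 + b t x ^ 2) * b t x)) t := by
    intro t x
    have h1 := congrArg Complex.im (hNLS t x)
    rw [hns] at h1
    have h2 := Complex.reCLM.hasFDerivAt.comp_hasDerivAt t (hψt' t x)
    refine h2.congr_deriv ?_
    simp only [hb11, Complex.reCLM_apply]
    rw [show -((ε : ℂ) ^ 2 / 2) = ((-(ε ^ 2 / 2) : ℝ) : ℂ) by push_cast; ring, mul_assoc,
      Complex.I_mul_im, Complex.add_im, Complex.re_ofReal_mul, Complex.im_ofReal_mul,
      Complex.im_ofReal_mul, Complex.im_sum] at h1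
    simp only [ha_def, hb_def] at h1 ⊢
    field_simp
    linarith
  have hbt : ∀ t x, HasDerivAt (fun s => b s x) (ε / 2 * (∑ j : Fin d, pd j (pd j (a t)) x)
      + -(1 / ε) * (h (a t x ^ 2 + b t x ^ 2) * a t x)) t := by
    intro t x
    have h1 := congrArg Complex.re (hNLS t x)
    rw [hns] at h1
    have h2 := Complex.imCLM.hasFDerivAt.comp_hasDerivAt t (hψt' t x)
    refine h2.congr_deriv ?_
    simp only [ha11, Complex.imCLM_apply]
    rw [show -((ε : ℂ) ^ 2 / 2) = ((-(ε ^ 2 / 2) : ℝ) : ℂ) by push_cast; ring, mul_assoc,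
      Complex.I_mul_re, Complex.add_re, Complex.im_ofReal_mul, Complex.re_ofReal_mul,
      Complex.re_ofReal_mul, Complex.re_sum] at h1
    simp only [ha_def, hb_def] at h1 ⊢
    field_simp
    linarith
  have hca : Continuous fun p : ℝ × EuclideanSpace ℝ (Fin d) => a p.1 p.2 :=
    Complex.continuous_re.comp hc0
  have hcb : Continuous fun p : ℝ × EuclideanSpace ℝ (Fin d) => b p.1 p.2 :=
    Complex.continuous_im.comp hc0
  have hca1 : ∀ i, Continuous fun p : ℝ × EuclideanSpace ℝ (Fin d) => pd i (a p.1) p.2 :=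
    fun i => by simp only [ha1]; exact Complex.continuous_re.comp (hc2 i)
  have hcb1 : ∀ i, Continuous fun p : ℝ × EuclideanSpace ℝ (Fin d) => pd i (b p.1) p.2 :=
    fun i => by simp only [hb1]; exact Complex.continuous_im.comp (hc2 i)
  have hca3 : ∀ i j, Continuous fun p : ℝ × EuclideanSpace ℝ (Fin d) =>
      pd i (pd j (pd j (a p.1))) p.2 := fun i j => by
    simp only [ha111]
    exact Complex.continuous_re.comp (hc4 i j j)
  have hcb3 : ∀ i j, Continuous fun p : ℝ × EuclideanSpace ℝ (Fin d) =>
      pd i (pd j (pd j (b p.1))) p.2 := fun i j => by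
    simp only [hb111]
    exact Complex.continuous_im.comp (hc4 i j j)
  have hnear_t : ∀ᶠ s in nhds t, ψ s x ≠ 0 :=
    (hψt x).continuous.continuousAt.eventually_ne hx
  have hnear_x : ∀ᶠ y in nhds x, ψ t y ≠ 0 :=
    (hψx t).continuous.continuousAt.eventually_ne hx
  have hr := hpos t x hx
  refine ⟨?_, fun i => ?_⟩
  · have hsum : ∀ j, pd j (fun y => ρ t y * u t y j) x =
        pd j (fun y => ε * (a t y * pd j (b t) y - b t y * pd j (a t) y)) x := fun j => by
      rw [pd, pd, Filter.EventuallyEq.fderiv_eq (hnear_x.mono fun y hy => hflux t y hy j)]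
    have hρt := (((hat t x).fun_pow 2).fun_add ((hbt t x).fun_pow 2)).congr_of_eventuallyEq
      (Filter.Eventually.of_forall fun s => (hρ s x).trans (hns s x))
    rw [hρt.deriv, Finset.sum_congr rfl fun j _ => hsum j,
      ← density_deriv_add_div_current (ha2 t) (hb2 t) ε (h (a t x ^ 2 + b t x ^ 2)) hε.ne' x]
    congr 1
    push_cast
    ring
  · have hmom :=
      (((hat t x).fun_mul (hasDerivAt_pd_of_schroedinger hh ha hb ha hca hcb hca (hca1 i) (hcb1 i)
          (hca1 i) (hca3 i) hdb hbt t x)).fun_sub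
        ((hbt t x).fun_mul (hasDerivAt_pd_of_schroedinger hh ha hb hb hca hcb hcb (hca1 i) (hcb1 i)
          (hcb1 i) (hcb3 i) hda hat t x))).const_mul ε
    have hmom' := hmom.congr_of_eventuallyEq (hnear_t.mono fun s hs => hflux s x hs i)
    have hconv : ∀ j, pd j (fun y => ρ t y * u t y i * u t y j) x =
        ε ^ 2 * pd j (fun y => (a t y * pd i (b t) y - b t y * pd i (a t) y)
          * (a t y * pd j (b t) y - b t y * pd j (a t) y) / (a t y ^ 2 + b t y ^ 2)) x := by
      intro j
      have D := (((hasPDerivAt_current (ha2 t) (hb2 t) i j x).mul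
        (hasPDerivAt_current (ha2 t) (hb2 t) j j x)).div
        (hasPDerivAt_sq_add_sq (hda t x) (hdb t x) j) hr.ne').1
      rw [← ((D.hasPDerivAt j).const_mul (ε ^ 2)).2, pd, pd,
        Filter.EventuallyEq.fderiv_eq (hnear_x.mono fun y hy => hflux2 t y hy i j)]
    have hpress : pd i (fun y => P (ρ t y)) x =
        (a t x ^ 2 + b t x ^ 2) * deriv h (a t x ^ 2 + b t x ^ 2)
          * (2 * (a t x * pd i (a t) x + b t x * pd i (b t) x)) := by
      have hPd := ((hP.differentiableOn (by norm_num)).differentiableAt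
        (Ioi_mem_nhds hr)).hasDerivAt
      rw [hP' _ hr] at hPd
      rw [hρ']
      exact ((hasPDerivAt_sq_add_sq (hda t x) (hdb t x) i).comp hPd).2
    have key := pd_flux_add_eq_bohm (ha t) (hb t) hr i
    rw [hmom'.deriv, Finset.sum_congr rfl fun j _ => hconv j, ← Finset.mul_sum, hpress, hρ']
    rw [← eq_sub_iff_add_eq] at key
    rw [key]
    field_simp
    ring
end

section
/- Let P : [0,∞) → ℝ be C¹ with P ≥ 0. Let (ρ, u) be a classical solution of the 1D QHD system on [0,1]×[0,T] with initial data ρ(x,0) = ρ_I(x) > 0, u(x,0) = u_I(x), satisfying for all t ∈ [0,T] the Neumann boundary conditions ρ_x(0,t) = ρ_x(1,t) = 0 and the boundary conditions (u² + P(ρ)/ρ − (√ρ)_xx/√ρ)(0,t) = c₁ and (u² + P(ρ)/ρ − (√ρ)_xx/√ρ)(1,t) = c₂ with constants c₁ ≤ 0, c₂ ≤ 0. If M₀ := ∫₀¹ (1−2x) ρ_I(x) u_I(x) dx < 0, then T ≤ T* := (∫₀¹ x(1−x) ρ_I(x) dx)/(−M₀). (Hence no classical solution with everywhere positive density exists beyond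 the finite time T*.) -/
open MeasureTheory Real Set

/-- Partial derivative in the first (space) variable. -/
noncomputable def pdx (f : ℝ → ℝ → ℝ) (x t : ℝ) : ℝ := deriv (fun y => f y t) x

/-- Partial derivative in the second (time) variable. -/
noncomputable def pdt (f : ℝ → ℝ → ℝ) (x t : ℝ) : ℝ := deriv (fun s => f x s) t

/-- Pointwise square root of a function of `(x, t)`. -/
noncomputable def sqf (ρ : ℝ → ℝ → ℝ) (x t : ℝ) : ℝ := Real.sqrt (ρ x t)

/-- A classical solution of the one-dimensional quantum hydrodynamic system (with ε² = 2)
`ρ_t + (ρu)_x = 0`, `(ρu)_t + (ρu² + P(ρ))_x = ρ·((√ρ)_xx/√ρ)_x` on `[0,1] × [0,T]`: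
`ρ > 0`, `ρ` of class `C¹` in `t` and `C³` in `x`, `u` of class `C¹` in `t` and `C²` in `x`,
all derivatives jointly continuous, and both equations hold pointwise. -/
structure IsQHDSolution1D (P : ℝ → ℝ) (ρ u : ℝ → ℝ → ℝ) (T : ℝ) : Prop where
  pos : ∀ x ∈ Set.Icc (0:ℝ) 1, ∀ t ∈ Set.Icc (0:ℝ) T, 0 < ρ x t
  rho_C3_x : ∀ t ∈ Set.Icc (0:ℝ) T, ContDiff ℝ 3 (fun x => ρ x t)
  rho_C1_t : ∀ x ∈ Set.Icc (0:ℝ) 1, ContDiff ℝ 1 (fun t => ρ x t)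
  u_C2_x : ∀ t ∈ Set.Icc (0:ℝ) T, ContDiff ℝ 2 (fun x => u x t)
  u_C1_t : ∀ x ∈ Set.Icc (0:ℝ) 1, ContDiff ℝ 1 (fun t => u x t)
  rho_cont : Continuous fun p : ℝ × ℝ => ρ p.1 p.2
  u_cont : Continuous fun p : ℝ × ℝ => u p.1 p.2
  rho_t_cont : Continuous fun p : ℝ × ℝ => pdt ρ p.1 p.2
  rho_x_cont : Continuous fun p : ℝ × ℝ => pdx ρ p.1 p.2
  rho_xx_cont : Continuous fun p : ℝ × ℝ => pdx (pdx ρ) p.1 p.2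
  rho_xxx_cont : Continuous fun p : ℝ × ℝ => pdx (pdx (pdx ρ)) p.1 p.2
  u_t_cont : Continuous fun p : ℝ × ℝ => pdt u p.1 p.2
  u_x_cont : Continuous fun p : ℝ × ℝ => pdx u p.1 p.2
  u_xx_cont : Continuous fun p : ℝ × ℝ => pdx (pdx u) p.1 p.2
  mass : ∀ x ∈ Set.Icc (0:ℝ) 1, ∀ t ∈ Set.Icc (0:ℝ) T,
    pdt ρ x t + pdx (fun y s => ρ y s * u y s) x t = 0
  momentum : ∀ x ∈ Set.Icc (0:ℝ) 1, ∀ t ∈ Set.Icc (0:ℝ) T,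
    pdt (fun y s => ρ y s * u y s) x t
      + pdx (fun y s => ρ y s * u y s ^ 2 + P (ρ y s)) x t
      = ρ x t * pdx (fun y s => pdx (pdx (sqf ρ)) y s / sqf ρ y s) x t

/-- Differentiation under the integral sign over a compact interval, for jointly continuous
integrand and derivative. -/
lemma hasDerivAt_intervalIntegral_of_continuous {a b : ℝ} (hab : a ≤ b) {f f' : ℝ → ℝ → ℝ}
    (hf : Continuous fun p : ℝ × ℝ => f p.1 p.2) (hf' : Continuous fun p : ℝ × ℝ => f' p.1 p.2)
    (hderiv : ∀ x ∈ Icc a b, ∀ t, HasDerivAt (fun s => f x s) (f' x t) t) (t : ℝ) :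
    HasDerivAt (fun s => ∫ x in a..b, f x s) (∫ x in a..b, f' x t) t := by
  have hfx (s : ℝ) : Continuous fun x => f x s := hf.comp (by fun_prop : Continuous fun x => (x, s))
  have hfx' (s : ℝ) : Continuous fun x => f' x s :=
    hf'.comp (by fun_prop : Continuous fun x => (x, s))
  obtain ⟨C, hC⟩ := ((isCompact_Icc (a := a) (b := b)).prod
    (isCompact_Icc (a := t - 1) (b := t + 1))).exists_bound_of_continuousOn hf'.continuousOn
  refine (intervalIntegral.hasDerivAt_integral_of_dominated_loc_of_deriv_le
    (F := fun s x => f x s) (F' := fun s x => f' x s) (bound := fun _ => C)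
    (Icc_mem_nhds (by linarith : t - 1 < t) (by linarith : t < t + 1))
    (.of_forall fun s => (hfx s).aestronglyMeasurable) ((hfx t).intervalIntegrable _ _)
    (hfx' t).aestronglyMeasurable (.of_forall fun x hx s hs => ?_)
    intervalIntegrable_const (.of_forall fun x hx s _ => ?_)).2
  · rw [uIoc_of_le hab] at hx
    exact hC (x, s) ⟨Ioc_subset_Icc_self hx, hs⟩
  · rw [uIoc_of_le hab] at hx
    exact hderiv x (Ioc_subset_Icc_self hx) s

/-- At a fixed time, the first moment of the momentum balance with weight `1 - 2x` is nonpositive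
when the fluxes through both end points are nonpositive. -/
lemma integral_momentum_rate_nonpos {P r v w : ℝ → ℝ} {c₁ c₂ : ℝ}
    (hP : ContDiffOn ℝ 1 P (Ici 0)) (hPnonneg : ∀ y ≥ (0 : ℝ), 0 ≤ P y)
    (hr : ContDiff ℝ 3 r) (hv : ContDiff ℝ 2 v) (hw : Continuous w)
    (hpos : ∀ x ∈ Icc (0 : ℝ) 1, 0 < r x) (hr0 : deriv r 0 = 0) (hr1 : deriv r 1 = 0)
    (hc₁ : c₁ ≤ 0) (hc₂ : c₂ ≤ 0)
    (hbc₀ : v 0 ^ 2 + P (r 0) / r 0 - deriv (deriv fun y => √(r y)) 0 / √(r 0) = c₁)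
    (hbc₁ : v 1 ^ 2 + P (r 1) / r 1 - deriv (deriv fun y => √(r y)) 1 / √(r 1) = c₂)
    (hmom : ∀ x ∈ Icc (0 : ℝ) 1, w x + deriv (fun y => r y * v y ^ 2 + P (r y)) x
      = r x * deriv (fun y => deriv (deriv fun z => √(r z)) y / √(r y)) x) :
    ∫ x in (0 : ℝ)..1, (1 - 2 * x) * w x ≤ 0 := by
  set s : ℝ → ℝ := fun y => √(r y) with hs
  have hU : IsOpen {x | 0 < r x} := isOpen_lt continuous_const hr.continuous
  have hsU : ContDiffOn ℝ 3 s {x | 0 < r x} := hr.contDiffOn.sqrt fun x hx => ne_of_gt hx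
  have hsU1 : ContDiffOn ℝ 2 (deriv s) {x | 0 < r x} := hsU.deriv_of_isOpen hU (by norm_num)
  have hsU2 : ContDiffOn ℝ 1 (deriv (deriv s)) {x | 0 < r x} :=
    hsU1.deriv_of_isOpen hU (by norm_num)
  have hderiv {n : WithTop ℕ∞} (hn : n ≠ 0) {f : ℝ → ℝ} (hf : ContDiffOn ℝ n f {x | 0 < r x})
      {x : ℝ} (hx : x ∈ Icc (0 : ℝ) 1) : HasDerivAt f (deriv f x) x :=
    ((hf.contDiffAt (hU.mem_nhds (hpos x hx))).differentiableAt hn).hasDerivAt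
  have hs_sq {x : ℝ} (hx : x ∈ Icc (0 : ℝ) 1) : s x ^ 2 = r x := Real.sq_sqrt (hpos x hx).le
  have hs_pos {x : ℝ} (hx : x ∈ Icc (0 : ℝ) 1) : 0 < s x := Real.sqrt_pos.2 (hpos x hx)
  have hds {x : ℝ} (hx : x ∈ Icc (0 : ℝ) 1) (h : deriv r x = 0) : deriv s x = 0 := by
    rw [hs, deriv_sqrt ((hr.differentiable (by norm_num)) x) (hpos x hx).ne', h, zero_div]
  have hflux : ∀ x ∈ Icc (0 : ℝ) 1, HasDerivAt
      (fun y => s y * deriv (deriv s) y - deriv s y ^ 2 - (r y * v y ^ 2 + P (r y))) (w x) x := by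
    intro x hx
    have h0 := hderiv (by norm_num) hsU hx
    have h1 := hderiv (by norm_num) hsU1 hx
    have h2 := hderiv (by norm_num) hsU2 hx
    have hPr : DifferentiableAt ℝ (fun y => P (r y)) x :=
      ((hP.contDiffAt (Ici_mem_nhds (hpos x hx))).differentiableAt one_ne_zero).comp x
        (hr.differentiable (by norm_num) x)
    have hconv : HasDerivAt (fun y => r y * v y ^ 2 + P (r y))
        (deriv (fun y => r y * v y ^ 2 + P (r y)) x) x :=
      (((hr.differentiable (by norm_num) x).mul
        ((hv.differentiable (by norm_num) x).pow 2)).add hPr).hasDerivAt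
    have hq := (h2.div h0 (hs_pos hx).ne').deriv
    have hm := hmom x hx
    have hq' : deriv (fun y => deriv (deriv s) y / s y) x = _ := hq
    rw [show (fun y => deriv (deriv s) y / √(r y)) = fun y => deriv (deriv s) y / s y from rfl,
      hq', ← hs_sq hx, mul_div_cancel₀ _ (pow_ne_zero 2 (hs_pos hx).ne')] at hm
    convert! ((h0.mul h2).sub (h1.pow 2)).sub hconv using 1
    simp only [Nat.cast_ofNat, Nat.add_one_sub_one, pow_one]
    linarith
  have hH : ∀ x ∈ Icc (0 : ℝ) 1, HasDerivAt
      (fun y => (1 - 2 * y) *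
        (s y * deriv (deriv s) y - deriv s y ^ 2 - (r y * v y ^ 2 + P (r y)))
        + 2 * (s y * deriv s y))
      ((1 - 2 * x) * w x + 4 * deriv s x ^ 2 + 2 * (r x * v x ^ 2 + P (r x))) x := by
    intro x hx
    have hlin : HasDerivAt (fun y : ℝ => 1 - 2 * y) (-2) x := by
      simpa using ((hasDerivAt_id x).const_mul 2).const_sub 1
    have h0 := hderiv (by norm_num) hsU hx
    have h1 := hderiv (by norm_num) hsU1 hx
    convert! (hlin.mul (hflux x hx)).add ((h0.mul h1).const_mul 2) using 1
    ring
  have hboundary {x c : ℝ} (hx : x ∈ Icc (0 : ℝ) 1) (h : deriv r x = 0)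
      (hc : v x ^ 2 + P (r x) / r x - deriv (deriv s) x / s x = c) :
      s x * deriv (deriv s) x - deriv s x ^ 2 - (r x * v x ^ 2 + P (r x)) = -(r x * c) := by
    have := hs_pos hx
    rw [hds hx h, ← hc, ← hs_sq hx]
    field_simp
    ring
  have h0 : (0 : ℝ) ∈ Icc (0 : ℝ) 1 := by simp
  have h1 : (1 : ℝ) ∈ Icc (0 : ℝ) 1 := by simp
  have key := intervalIntegral.integral_le_sub_of_hasDeriv_right_of_le zero_le_one
    (fun x hx => (hH x hx).continuousAt.continuousWithinAt)
    (fun x hx => (hH x (Ioo_subset_Icc_self hx)).hasDerivWithinAt)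
    (φ := fun x => (1 - 2 * x) * w x) (Continuous.integrableOn_Icc (by fun_prop))
    (fun x hx => by
      have hrx := hpos x (Ioo_subset_Icc_self hx)
      have := hPnonneg (r x) hrx.le
      have : 0 ≤ r x * v x ^ 2 := by positivity
      nlinarith [sq_nonneg (deriv s x)])
  refine key.trans ?_
  rw [hboundary h0 hr0 hbc₀, hboundary h1 hr1 hbc₁, hds h0 hr0, hds h1 hr1]
  nlinarith [mul_nonpos_of_nonneg_of_nonpos (hpos 0 h0).le hc₁,
    mul_nonpos_of_nonneg_of_nonpos (hpos 1 h1).le hc₂]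

/-- At a fixed time, the rate of change of the `x(1-x)` moment of the density is the
`1 - 2x` moment of the momentum. -/
lemma integral_moment_continuity {j q : ℝ → ℝ} (hj : Differentiable ℝ j) (hq : Continuous q)
    (hmass : ∀ x ∈ Icc (0 : ℝ) 1, q x + deriv j x = 0) :
    ∫ x in (0 : ℝ)..1, x * (1 - x) * q x = ∫ x in (0 : ℝ)..1, (1 - 2 * x) * j x := by
  have hjc := hj.continuous
  have hi₁ : IntervalIntegrable (fun x => x * (1 - x) * q x) volume 0 1 :=
    Continuous.intervalIntegrable (by fun_prop) _ _
  have hi₂ : IntervalIntegrable (fun x => (1 - 2 * x) * j x) volume 0 1 :=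
    Continuous.intervalIntegrable (by fun_prop) _ _
  have h := intervalIntegral.integral_eq_sub_of_hasDerivAt
    (f := fun x => x * (1 - x) * j x) (fun x hx => ?_) (hi₂.sub hi₁)
  · rw [intervalIntegral.integral_sub hi₂ hi₁] at h
    linarith
  · rw [uIcc_of_le zero_le_one] at hx
    have hlin : HasDerivAt (fun y : ℝ => y * (1 - y)) (1 - 2 * x) x := by
      convert! (hasDerivAt_id x).mul ((hasDerivAt_id x).const_sub 1) using 1
      simp; ring
    convert! hlin.mul (hj x).hasDerivAt using 1
    rw [eq_neg_of_add_eq_zero_left (hmass x hx)]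
    ring

/-- A function with nonpositive derivative on `[0, T]` is bounded there by its initial value. -/
lemma le_initial_of_hasDerivAt_nonpos {T : ℝ} {f f' : ℝ → ℝ}
    (hf : ∀ t, HasDerivAt f (f' t) t) (hf' : ∀ t ∈ Icc 0 T, f' t ≤ 0) :
    ∀ t ∈ Icc 0 T, f t ≤ f 0 := by
  have hd : Differentiable ℝ f := fun t => (hf t).differentiableAt
  have h := antitoneOn_of_deriv_nonpos (convex_Icc 0 T) hd.continuous.continuousOn
    hd.differentiableOn fun t ht => (hf t).deriv ▸ hf' t (interior_subset ht)
  exact fun t ht => h ⟨le_rfl, ht.1.trans ht.2⟩ ht ht.1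

/-- Blow-up in finite time for the 1D QHD system with nonpositive momentum-flux boundary
conditions: if `M₀ = ∫₀¹ (1-2x) ρ_I u_I dx < 0` then the existence time `T` is at most
`T* = (∫₀¹ x(1-x) ρ_I dx)/(-M₀)`. -/
theorem qhd1d_blowup
    (P : ℝ → ℝ) (hP : ContDiffOn ℝ 1 P (Set.Ici 0)) (hPnonneg : ∀ r ≥ (0:ℝ), 0 ≤ P r)
    (T : ℝ) (hT : 0 ≤ T) (ρ u : ℝ → ℝ → ℝ) (ρI uI : ℝ → ℝ)
    (hsol : IsQHDSolution1D P ρ u T)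
    (hρI : ∀ x ∈ Set.Icc (0:ℝ) 1, ρ x 0 = ρI x)
    (hρIpos : ∀ x ∈ Set.Icc (0:ℝ) 1, 0 < ρI x)
    (huI : ∀ x ∈ Set.Icc (0:ℝ) 1, u x 0 = uI x)
    (hNeumann : ∀ t ∈ Set.Icc (0:ℝ) T, pdx ρ 0 t = 0 ∧ pdx ρ 1 t = 0)
    (c₁ c₂ : ℝ) (hc₁ : c₁ ≤ 0) (hc₂ : c₂ ≤ 0)
    (hbc₀ : ∀ t ∈ Set.Icc (0:ℝ) T,
      u 0 t ^ 2 + P (ρ 0 t) / ρ 0 t - pdx (pdx (sqf ρ)) 0 t / sqf ρ 0 t = c₁)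
    (hbc₁ : ∀ t ∈ Set.Icc (0:ℝ) T,
      u 1 t ^ 2 + P (ρ 1 t) / ρ 1 t - pdx (pdx (sqf ρ)) 1 t / sqf ρ 1 t = c₂)
    (M₀ : ℝ) (hM₀ : M₀ = ∫ x in (0:ℝ)..1, (1 - 2 * x) * ρI x * uI x) (hM₀neg : M₀ < 0) :
    T ≤ (∫ x in (0:ℝ)..1, x * (1 - x) * ρI x) / (-M₀) := by
  have hρd : ∀ x ∈ Icc (0 : ℝ) 1, ∀ t, HasDerivAt (fun s => ρ x s) (pdt ρ x t) t :=
    fun x hx t => ((hsol.rho_C1_t x hx).differentiable one_ne_zero t).hasDerivAt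
  have hud : ∀ x ∈ Icc (0 : ℝ) 1, ∀ t, HasDerivAt (fun s => u x s) (pdt u x t) t :=
    fun x hx t => ((hsol.u_C1_t x hx).differentiable one_ne_zero t).hasDerivAt
  have hρc := hsol.rho_cont
  have huc := hsol.u_cont
  have hρtc := hsol.rho_t_cont
  have hutc := hsol.u_t_cont
  let w : ℝ → ℝ → ℝ := fun x t => pdt ρ x t * u x t + ρ x t * pdt u x t
  have hwc : Continuous fun p : ℝ × ℝ => w p.1 p.2 := by
    change Continuous fun p : ℝ × ℝ => pdt ρ p.1 p.2 * u p.1 p.2 + ρ p.1 p.2 * pdt u p.1 p.2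
    fun_prop
  have hslice {f : ℝ → ℝ → ℝ} (hf : Continuous fun p : ℝ × ℝ => f p.1 p.2) (t : ℝ) :
      Continuous fun x => f x t := hf.comp (by fun_prop : Continuous fun x : ℝ => (x, t))
  have hI := hasDerivAt_intervalIntegral_of_continuous (a := 0) (b := 1) zero_le_one
    (f := fun x t => x * (1 - x) * ρ x t) (f' := fun x t => x * (1 - x) * pdt ρ x t)
    (by fun_prop) (by fun_prop) fun x hx t => (hρd x hx t).const_mul _
  have hM := hasDerivAt_intervalIntegral_of_continuous (a := 0) (b := 1) zero_le_one
    (f := fun x t => (1 - 2 * x) * (ρ x t * u x t)) (f' := fun x t => (1 - 2 * x) * w x t)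
    (by fun_prop) (by fun_prop) fun x hx t => ((hρd x hx t).mul (hud x hx t)).const_mul _
  have hM' : ∀ t ∈ Icc 0 T, ∫ x in (0 : ℝ)..1, (1 - 2 * x) * w x t ≤ 0 := fun t ht =>
    integral_momentum_rate_nonpos hP hPnonneg (hsol.rho_C3_x t ht) (hsol.u_C2_x t ht)
      (hslice hwc t) (fun x hx => hsol.pos x hx t ht) (hNeumann t ht).1 (hNeumann t ht).2
      hc₁ hc₂ (hbc₀ t ht) (hbc₁ t ht) fun x hx => by
        have hwx : pdt (fun y s => ρ y s * u y s) x t = w x t :=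
          ((hρd x hx t).mul (hud x hx t)).deriv
        rw [← hwx]
        exact hsol.momentum x hx t ht
  have hM0 : ∫ x in (0 : ℝ)..1, (1 - 2 * x) * (ρ x 0 * u x 0) = M₀ := by
    rw [hM₀]
    refine intervalIntegral.integral_congr fun x hx => ?_
    rw [uIcc_of_le zero_le_one] at hx
    simp only [hρI x hx, huI x hx, mul_assoc]
  have hI0 : ∫ x in (0 : ℝ)..1, x * (1 - x) * ρ x 0 = ∫ x in (0 : ℝ)..1, x * (1 - x) * ρI x := by
    refine intervalIntegral.integral_congr fun x hx => ?_
    rw [uIcc_of_le zero_le_one] at hx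
    simp only [hρI x hx]
  have hMle := le_initial_of_hasDerivAt_nonpos hM hM'
  have hIle := le_initial_of_hasDerivAt_nonpos (T := T)
    (fun t => (hI t).sub ((hasDerivAt_id t).const_mul M₀)) (fun t ht => by
      have hflux : Differentiable ℝ fun x => ρ x t * u x t :=
        ((hsol.rho_C3_x t ht).differentiable (by norm_num)).mul
          ((hsol.u_C2_x t ht).differentiable (by norm_num))
      have := hMle t ht
      rw [integral_moment_continuity hflux (hslice hρtc t) fun x hx => hsol.mass x hx t ht]
      linarith) T ⟨hT, le_rfl⟩
  have hnonneg : 0 ≤ ∫ x in (0 : ℝ)..1, x * (1 - x) * ρ x T :=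
    intervalIntegral.integral_nonneg zero_le_one fun x hx =>
      mul_nonneg (mul_nonneg hx.1 (by linarith [hx.2])) (hsol.pos x hx T ⟨hT, le_rfl⟩).le
  rw [le_div_iff₀ (by linarith), ← hI0]
  simp only [Pi.sub_apply, id] at hIle
  linarith
end

section
/- Let P : [0,∞) → ℝ be C¹ and let (ρ, u) be a classical solution of the 1D QHD system on [0,1]×[0,T] with initial data ρ(·,0) = ρ_I, u(·,0) = u_I, satisfying ρ_x(0,t) = ρ_x(1,t) = 0 for all t ∈ [0,T]. Let I(t) := ∫₀¹ x(1−x) ρ(x,t) dx. Then for every t ∈ [0,T]: I'(t) = ∫₀¹ (1−2x) ρ_I u_I dx − 2 ∫₀ᵗ ∫₀¹ (ρu² + P(ρ) + 2((√ρ)_x)²) dx ds + ∫₀ᵗ ρ·(u² + P(ρ)/ρ − (√ρ)_xx/√ρ)(1,s) ds + ∫₀ᵗ ρ·(u² + P(ρ)/ρ − (√ρ)_xx/√ρ)(0,s) ds. -/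
open MeasureTheory Real Set

/-- Leibniz rule for a parametric integral over a compact interval, the integrand having a jointly
continuous time derivative. -/
theorem hasDerivAt_integral_of_continuous_deriv {f g : ℝ → ℝ → ℝ} {a b : ℝ} (hab : a ≤ b)
    (hf : Continuous fun p : ℝ × ℝ => f p.1 p.2) (hg : Continuous fun p : ℝ × ℝ => g p.1 p.2)
    (hfg : ∀ x ∈ Icc a b, ∀ t, HasDerivAt (fun s => f x s) (g x t) t) (t : ℝ) :
    HasDerivAt (fun s => ∫ x in a..b, f x s) (∫ x in a..b, g x t) t := by
  obtain ⟨C, hC⟩ := ((isCompact_Icc (a := a) (b := b)).prod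
    (isCompact_Icc (a := t - 1) (b := t + 1))).exists_bound_of_continuousOn hg.continuousOn
  have hslice : ∀ {h : ℝ → ℝ → ℝ}, (Continuous fun p : ℝ × ℝ => h p.1 p.2) →
      ∀ s, Continuous fun x => h x s := fun hh s => by
    exact hh.comp (continuous_id.prodMk continuous_const)
  have hsub : ∀ x ∈ uIoc a b, x ∈ Icc a b := fun x hx => by
    rw [uIoc_of_le hab] at hx
    exact Ioc_subset_Icc_self hx
  refine (intervalIntegral.hasDerivAt_integral_of_dominated_loc_of_deriv_le
    (F := fun s x => f x s) (F' := fun s x => g x s) (bound := fun _ => C)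
    (Metric.ball_mem_nhds t one_pos) ?_ ((hslice hf t).intervalIntegrable _ _)
    (hslice hg t).aestronglyMeasurable ?_ intervalIntegrable_const ?_).2
  · exact Filter.Eventually.of_forall fun s => (hslice hf s).aestronglyMeasurable
  · refine Filter.Eventually.of_forall fun x hx s hs => hC (x, s) ⟨hsub x hx, ?_⟩
    rw [Real.ball_eq_Ioo] at hs
    exact Ioo_subset_Icc_self hs
  · exact Filter.Eventually.of_forall fun x hx s _ => hfg x (hsub x hx) s

/-- The square root of a positive `C³` function is three times differentiable. -/
theorem sqrt_derivatives {r : ℝ → ℝ} (hr : ContDiff ℝ 3 r) {x : ℝ} (hx : 0 < r x) :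
    HasDerivAt (fun y => √(r y)) (deriv (fun y => √(r y)) x) x ∧
    HasDerivAt (deriv fun y => √(r y)) (deriv (deriv fun y => √(r y)) x) x ∧
    HasDerivAt (deriv (deriv fun y => √(r y))) (deriv (deriv (deriv fun y => √(r y))) x) x := by
  have hU : IsOpen {y | 0 < r y} := isOpen_lt continuous_const hr.continuous
  have h0 : ContDiffOn ℝ 3 (fun y => √(r y)) {y | 0 < r y} :=
    hr.contDiffOn.sqrt fun y hy => (ne_of_gt hy)
  have h1 : ContDiffOn ℝ 2 (deriv fun y => √(r y)) {y | 0 < r y} :=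
    h0.deriv_of_isOpen hU (by norm_num)
  have h2 : ContDiffOn ℝ 1 (deriv (deriv fun y => √(r y))) {y | 0 < r y} :=
    h1.deriv_of_isOpen hU (by norm_num)
  have hd : ∀ {f : ℝ → ℝ}, DifferentiableOn ℝ f {y | 0 < r y} → HasDerivAt f (deriv f x) x :=
    fun hf => (hf.differentiableAt (hU.mem_nhds hx)).hasDerivAt
  exact ⟨hd (h0.differentiableOn (by norm_num)), hd (h1.differentiableOn (by norm_num)),
    hd (h2.differentiableOn (by norm_num))⟩

/-- The second derivative of the square root of a positive function. -/
theorem deriv_deriv_sqrt {r : ℝ → ℝ} (hr : ContDiff ℝ 2 r) {x : ℝ} (hx : 0 < r x) :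
    deriv (deriv fun y => √(r y)) x
      = deriv (deriv r) x / (2 * √(r x)) - deriv r x ^ 2 / (4 * √(r x) ^ 3) := by
  have hrd : ∀ y, HasDerivAt r (deriv r y) y := fun y =>
    (hr.differentiable (by norm_num) y).hasDerivAt
  have hrdd : HasDerivAt (deriv r) (deriv (deriv r) x) x :=
    (((contDiff_succ_iff_deriv (n := 1)).1 hr).2.2.differentiable (by norm_num) x).hasDerivAt
  have hev : (deriv fun y => √(r y)) =ᶠ[nhds x] fun y => deriv r y / (2 * √(r y)) := by
    filter_upwards [hr.continuous.continuousAt.eventually_ne hx.ne'] with y hy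
    exact ((hrd y).sqrt hy).deriv
  have hw : 0 < √(r x) := Real.sqrt_pos.2 hx
  rw [hev.deriv_eq]
  refine (hrdd.div (((hrd x).sqrt hx.ne').const_mul 2) (by positivity)).deriv.trans ?_
  field_simp
  ring

/-- The momentum balance at a fixed time, integrated against the weight `1 - 2x`, under Neumann
boundary conditions for the density `r`. -/
theorem integral_weighted_momentum_flux {P : ℝ → ℝ} (hP : ContDiffOn ℝ 1 P (Ici 0))
    {r v F : ℝ → ℝ} (hr : ContDiff ℝ 3 r) (hv : ContDiff ℝ 2 v)
    (hpos : ∀ x ∈ Icc (0 : ℝ) 1, 0 < r x) (hr0 : deriv r 0 = 0) (hr1 : deriv r 1 = 0)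
    (hF : Continuous F)
    (hmom : ∀ x ∈ Icc (0 : ℝ) 1, F x + deriv (fun y => r y * v y ^ 2 + P (r y)) x
      = r x * deriv (fun y => deriv (deriv fun z => √(r z)) y / √(r y)) x) :
    (∫ x in (0 : ℝ)..1, (1 - 2 * x) * F x)
      + 2 * (∫ x in (0 : ℝ)..1, (r x * v x ^ 2 + P (r x) + 2 * (deriv (fun y => √(r y)) x) ^ 2))
      = r 1 * (v 1 ^ 2 + P (r 1) / r 1 - deriv (deriv fun y => √(r y)) 1 / √(r 1))
        + r 0 * (v 0 ^ 2 + P (r 0) / r 0 - deriv (deriv fun y => √(r y)) 0 / √(r 0)) := by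
  set w : ℝ → ℝ := fun y => √(r y) with hw
  have hwsq : ∀ x ∈ Icc (0 : ℝ) 1, w x ^ 2 = r x := fun x hx => Real.sq_sqrt (hpos x hx).le
  have hwpos : ∀ x ∈ Icc (0 : ℝ) 1, 0 < w x := fun x hx => Real.sqrt_pos.2 (hpos x hx)
  have hrd : ∀ x, HasDerivAt r (deriv r x) x := fun x =>
    (hr.differentiable (by norm_num) x).hasDerivAt
  have hPr : ∀ x ∈ Icc (0 : ℝ) 1, DifferentiableAt ℝ (fun y => P (r y)) x := fun x hx =>
    ((hP.differentiableOn (by norm_num)).differentiableAt (Ici_mem_nhds (hpos x hx))).comp x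
      (hrd x).differentiableAt
  have hpress : ∀ x ∈ Icc (0 : ℝ) 1, HasDerivAt (fun y => r y * v y ^ 2 + P (r y))
      (deriv (fun y => r y * v y ^ 2 + P (r y)) x) x := fun x hx =>
    (((hrd x).differentiableAt.mul ((hv.differentiable (by norm_num) x).pow 2)).add
      (hPr x hx)).hasDerivAt
  have hprim : ∀ x ∈ Icc (0 : ℝ) 1, HasDerivAt
      (fun y => (1 - 2 * y) * (w y * deriv (deriv w) y - deriv w y ^ 2
        - (r y * v y ^ 2 + P (r y))) + 2 * (w y * deriv w y))
      ((1 - 2 * x) * F x + 2 * (r x * v x ^ 2 + P (r x) + 2 * (deriv w x) ^ 2)) x := by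
    intro x hx
    obtain ⟨h0, h1, h2⟩ := sqrt_derivatives hr (hpos x hx)
    have hne : w x ≠ 0 := (hwpos x hx).ne'
    have hq := (h2.div h0 hne).deriv
    have hm := hmom x hx
    have hq' : deriv (fun y => deriv (deriv w) y / √(r y)) x
      = (deriv (deriv (deriv w)) x * w x - deriv (deriv w) x * deriv w x) / w x ^ 2 := hq
    rw [hq', hwsq x hx, mul_div_cancel₀ _ (hpos x hx).ne'] at hm
    have hlin : HasDerivAt (fun y : ℝ => 1 - 2 * y) (-2) x := by
      simpa using ((hasDerivAt_id x).const_mul 2).const_sub 1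
    refine ((hlin.mul (((h0.mul h2).sub (h1.pow 2)).sub (hpress x hx))).add
      ((h0.mul h1).const_mul 2)).congr_deriv ?_
    simp only [Pi.sub_apply, Pi.mul_apply, Pi.pow_apply]
    rw [eq_sub_of_add_eq hm]
    push_cast
    ring
  have hK : ContinuousOn (fun x => r x * v x ^ 2 + P (r x) + 2 * (deriv w x) ^ 2)
      (uIcc 0 1) := by
    rw [uIcc_of_le zero_le_one]
    intro x hx
    exact (((hpress x hx).continuousAt).add
      (((sqrt_derivatives hr (hpos x hx)).2.1.continuousAt.pow 2).const_mul
        2)).continuousWithinAt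
  have hL : Continuous fun x : ℝ => (1 - 2 * x) * F x := by fun_prop
  have hKi := hK.intervalIntegrable (μ := volume)
  have hftc := intervalIntegral.integral_eq_sub_of_hasDerivAt
    (fun x hx => hprim x (by rwa [uIcc_of_le zero_le_one] at hx))
    ((hL.intervalIntegrable 0 1).add (hKi.const_mul 2))
  rw [intervalIntegral.integral_add (hL.intervalIntegrable 0 1) (hKi.const_mul 2),
    intervalIntegral.integral_const_mul] at hftc
  have m0 : (0 : ℝ) ∈ Icc (0 : ℝ) 1 := by simp
  have m1 : (1 : ℝ) ∈ Icc (0 : ℝ) 1 := by simp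
  have hw' : ∀ x ∈ Icc (0 : ℝ) 1, deriv r x = 0 → deriv w x = 0 := fun x hx h => by
    rw [((hrd x).sqrt (hpos x hx).ne').deriv, h, zero_div]
  have hbd : ∀ x ∈ Icc (0 : ℝ) 1, r x * (v x ^ 2 + P (r x) / r x - deriv (deriv w) x / √(r x))
      = r x * v x ^ 2 + P (r x) - w x * deriv (deriv w) x := fun x hx => by
    have h1 := (hpos x hx).ne'
    have h2 := (hwpos x hx).ne'
    change r x * (v x ^ 2 + P (r x) / r x - deriv (deriv w) x / w x) = _
    have h3 : r x * (deriv (deriv w) x / w x) = w x * deriv (deriv w) x := by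
      rw [← hwsq x hx]
      field_simp
    rw [mul_sub, mul_add, mul_div_cancel₀ _ h1, h3]
  rw [hftc, hbd 0 m0, hbd 1 m1, hw' 0 m0 hr0, hw' 1 m1 hr1]
  ring

/-- Identity for the time derivative of the observable `I(t) = ∫₀¹ x(1−x) ρ(x,t) dx` for the
1D QHD system with Neumann boundary conditions for `ρ`. -/
theorem qhd1d_observable_derivative
    (P : ℝ → ℝ) (hP : ContDiffOn ℝ 1 P (Set.Ici 0))
    (T : ℝ) (hT : 0 ≤ T) (ρ u : ℝ → ℝ → ℝ) (ρI uI : ℝ → ℝ)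
    (hsol : IsQHDSolution1D P ρ u T)
    (hρI : ∀ x ∈ Set.Icc (0:ℝ) 1, ρ x 0 = ρI x)
    (huI : ∀ x ∈ Set.Icc (0:ℝ) 1, u x 0 = uI x)
    (hNeumann : ∀ t ∈ Set.Icc (0:ℝ) T, pdx ρ 0 t = 0 ∧ pdx ρ 1 t = 0)
    (I : ℝ → ℝ) (hI : ∀ t : ℝ, I t = ∫ x in (0:ℝ)..1, x * (1 - x) * ρ x t) :
    ∀ t ∈ Set.Icc (0:ℝ) T,
      HasDerivWithinAt I
        ((∫ x in (0:ℝ)..1, (1 - 2 * x) * ρI x * uI x)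
          - 2 * (∫ s in (0:ℝ)..t, ∫ x in (0:ℝ)..1,
              (ρ x s * u x s ^ 2 + P (ρ x s) + 2 * (pdx (sqf ρ) x s) ^ 2))
          + (∫ s in (0:ℝ)..t,
              ρ 1 s * (u 1 s ^ 2 + P (ρ 1 s) / ρ 1 s - pdx (pdx (sqf ρ)) 1 s / sqf ρ 1 s))
          + ∫ s in (0:ℝ)..t,
              ρ 0 s * (u 0 s ^ 2 + P (ρ 0 s) / ρ 0 s - pdx (pdx (sqf ρ)) 0 s / sqf ρ 0 s))
        (Set.Icc 0 T) t := by
  intro t ht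
  have m0 : (0 : ℝ) ∈ Icc (0 : ℝ) 1 := by simp
  have m1 : (1 : ℝ) ∈ Icc (0 : ℝ) 1 := by simp
  have cρ := hsol.rho_cont
  have cu := hsol.u_cont
  have cρt := hsol.rho_t_cont
  have cut := hsol.u_t_cont
  have dρt : ∀ x ∈ Icc (0 : ℝ) 1, ∀ s, HasDerivAt (fun s => ρ x s) (pdt ρ x s) s :=
    fun x hx s => ((hsol.rho_C1_t x hx).differentiable (by norm_num) s).hasDerivAt
  have dut : ∀ x ∈ Icc (0 : ℝ) 1, ∀ s, HasDerivAt (fun s => u x s) (pdt u x s) s :=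
    fun x hx s => ((hsol.u_C1_t x hx).differentiable (by norm_num) s).hasDerivAt
  have hslice : ∀ {h : ℝ → ℝ → ℝ}, (Continuous fun p : ℝ × ℝ => h p.1 p.2) →
      ∀ s, Continuous fun x => h x s := fun hh s => by
    exact hh.comp (continuous_id.prodMk continuous_const)
  have hslice' : ∀ {h : ℝ → ℝ → ℝ}, (Continuous fun p : ℝ × ℝ => h p.1 p.2) →
      ∀ x, Continuous fun s => h x s := fun hh x => by
    exact hh.comp (continuous_const.prodMk continuous_id)
  have hI' : HasDerivAt I (∫ x in (0 : ℝ)..1, x * (1 - x) * pdt ρ x t) t := by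
    rw [show I = fun s => ∫ x in (0 : ℝ)..1, x * (1 - x) * ρ x s from funext hI]
    exact hasDerivAt_integral_of_continuous_deriv (f := fun x s => x * (1 - x) * ρ x s)
      (g := fun x s => x * (1 - x) * pdt ρ x s) zero_le_one (by fun_prop) (by fun_prop)
      (fun x hx s => (dρt x hx s).const_mul _) t
  have hmass : (∫ x in (0 : ℝ)..1, x * (1 - x) * pdt ρ x t)
      = ∫ x in (0 : ℝ)..1, (1 - 2 * x) * (ρ x t * u x t) := by
    have hd : ∀ x ∈ uIcc (0 : ℝ) 1, HasDerivAt (fun y => y * (1 - y) * (ρ y t * u y t))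
        ((1 - 2 * x) * (ρ x t * u x t) - x * (1 - x) * pdt ρ x t) x := by
      intro x hx
      rw [uIcc_of_le zero_le_one] at hx
      have hM : HasDerivAt (fun y => ρ y t * u y t) (pdx (fun y s => ρ y s * u y s) x t) x :=
        ((((hsol.rho_C3_x t ht).differentiable (by norm_num)) x).mul
          (((hsol.u_C2_x t ht).differentiable (by norm_num)) x)).hasDerivAt
      refine (((hasDerivAt_id x).mul ((hasDerivAt_id x).const_sub 1)).mul hM).congr_deriv ?_
      simp only [Pi.mul_apply, id]
      rw [eq_neg_of_add_eq_zero_right (hsol.mass x hx t ht)]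
      ring
    have c1 : Continuous fun x => (1 - 2 * x) * (ρ x t * u x t) := by
      have := hslice cρ t
      have := hslice cu t
      fun_prop
    have c2 : Continuous fun x => x * (1 - x) * pdt ρ x t := by
      have := hslice cρt t
      fun_prop
    have h := intervalIntegral.integral_eq_sub_of_hasDerivAt hd
      ((c1.sub c2).intervalIntegrable 0 1)
    rw [intervalIntegral.integral_sub (c1.intervalIntegrable 0 1)
      (c2.intervalIntegrable 0 1)] at h
    linarith
  have cN : Continuous fun p : ℝ × ℝ =>
      (1 - 2 * p.1) * (pdt ρ p.1 p.2 * u p.1 p.2 + ρ p.1 p.2 * pdt u p.1 p.2) := by fun_prop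
  have cL : Continuous fun s => ∫ x in (0 : ℝ)..1,
      (1 - 2 * x) * (pdt ρ x s * u x s + ρ x s * pdt u x s) :=
    intervalIntegral.continuous_parametric_intervalIntegral_of_continuous'
      (f := fun s x => (1 - 2 * x) * (pdt ρ x s * u x s + ρ x s * pdt u x s))
      (cN.comp continuous_swap) 0 1
  have hmoment : (∫ s in (0 : ℝ)..t, ∫ x in (0 : ℝ)..1,
        (1 - 2 * x) * (pdt ρ x s * u x s + ρ x s * pdt u x s))
      = (∫ x in (0 : ℝ)..1, (1 - 2 * x) * (ρ x t * u x t))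
        - ∫ x in (0 : ℝ)..1, (1 - 2 * x) * (ρ x 0 * u x 0) :=
    intervalIntegral.integral_eq_sub_of_hasDerivAt
      (fun s _ => hasDerivAt_integral_of_continuous_deriv
        (f := fun x s => (1 - 2 * x) * (ρ x s * u x s)) zero_le_one (by fun_prop) cN
        (fun x hx s => ((dρt x hx s).mul (dut x hx s)).const_mul _) s)
      (cL.intervalIntegrable 0 t)
  have hinit : (∫ x in (0 : ℝ)..1, (1 - 2 * x) * ρI x * uI x)
      = ∫ x in (0 : ℝ)..1, (1 - 2 * x) * (ρ x 0 * u x 0) := by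
    refine intervalIntegral.integral_congr fun x hx => ?_
    rw [uIcc_of_le zero_le_one] at hx
    simp only [← hρI x hx, ← huI x hx, mul_assoc]
  have hflux : ∀ s ∈ Icc (0 : ℝ) T, (∫ x in (0 : ℝ)..1,
        (ρ x s * u x s ^ 2 + P (ρ x s) + 2 * (pdx (sqf ρ) x s) ^ 2))
      = (ρ 1 s * (u 1 s ^ 2 + P (ρ 1 s) / ρ 1 s - pdx (pdx (sqf ρ)) 1 s / sqf ρ 1 s)
        + ρ 0 s * (u 0 s ^ 2 + P (ρ 0 s) / ρ 0 s - pdx (pdx (sqf ρ)) 0 s / sqf ρ 0 s)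
        - ∫ x in (0 : ℝ)..1, (1 - 2 * x) * (pdt ρ x s * u x s + ρ x s * pdt u x s)) / 2 := by
    intro s hs
    have h := integral_weighted_momentum_flux hP
      (F := fun x => pdt ρ x s * u x s + ρ x s * pdt u x s)
      (hsol.rho_C3_x s hs) (hsol.u_C2_x s hs)
      (fun x hx => hsol.pos x hx s hs) (hNeumann s hs).1 (hNeumann s hs).2
      (((hslice cρt s).mul (hslice cu s)).add ((hslice cρ s).mul (hslice cut s)))
      (fun x hx => by
        have hm := hsol.momentum x hx s hs
        rw [show pdt (fun y s => ρ y s * u y s) x s = pdt ρ x s * u x s + ρ x s * pdt u x s from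
          ((dρt x hx s).mul (dut x hx s)).deriv] at hm
        exact hm)
    have h' : (∫ x in (0 : ℝ)..1, (1 - 2 * x) * (pdt ρ x s * u x s + ρ x s * pdt u x s))
        + 2 * (∫ x in (0 : ℝ)..1,
          (ρ x s * u x s ^ 2 + P (ρ x s) + 2 * (pdx (sqf ρ) x s) ^ 2))
        = ρ 1 s * (u 1 s ^ 2 + P (ρ 1 s) / ρ 1 s - pdx (pdx (sqf ρ)) 1 s / sqf ρ 1 s)
          + ρ 0 s * (u 0 s ^ 2 + P (ρ 0 s) / ρ 0 s - pdx (pdx (sqf ρ)) 0 s / sqf ρ 0 s) := h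
    linarith
  have hB : ∀ x ∈ Icc (0 : ℝ) 1, IntervalIntegrable (fun s => ρ x s *
      (u x s ^ 2 + P (ρ x s) / ρ x s - pdx (pdx (sqf ρ)) x s / sqf ρ x s)) volume 0 t := by
    intro x hx
    have hsub : uIcc 0 t ⊆ Icc 0 T := by
      rw [uIcc_of_le ht.1]
      exact Icc_subset_Icc_right ht.2
    have hne : ∀ s ∈ Icc 0 T, ρ x s ≠ 0 := fun s hs => (hsol.pos x hx s hs).ne'
    have hsq : ∀ s ∈ Icc 0 T, sqf ρ x s ≠ 0 := fun s hs =>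
      (Real.sqrt_pos.2 (hsol.pos x hx s hs)).ne'
    have kρ := (hslice' cρ x).continuousOn (s := Icc 0 T)
    have ku := (hslice' cu x).continuousOn (s := Icc 0 T)
    have kx := (hslice' hsol.rho_x_cont x).continuousOn (s := Icc 0 T)
    have kxx := (hslice' hsol.rho_xx_cont x).continuousOn (s := Icc 0 T)
    have kw : ContinuousOn (fun s => sqf ρ x s) (Icc 0 T) := kρ.sqrt
    have kP : ContinuousOn (fun s => P (ρ x s)) (Icc 0 T) :=
      hP.continuousOn.comp kρ fun s hs => (hsol.pos x hx s hs).le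
    have kww : ContinuousOn (fun s => pdx (pdx (sqf ρ)) x s) (Icc 0 T) := by
      have : ContinuousOn (fun s => pdx (pdx ρ) x s / (2 * sqf ρ x s)
          - pdx ρ x s ^ 2 / (4 * sqf ρ x s ^ 3)) (Icc 0 T) :=
        (kxx.div (kw.const_mul 2) fun s hs => mul_ne_zero two_ne_zero (hsq s hs)).sub
          ((kx.pow 2).div ((kw.pow 3).const_mul 4) fun s hs =>
            mul_ne_zero four_ne_zero (pow_ne_zero 3 (hsq s hs)))
      exact this.congr fun s hs =>
        deriv_deriv_sqrt ((hsol.rho_C3_x s hs).of_le (by norm_num)) (hsol.pos x hx s hs)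
    exact ((kρ.mul (((ku.pow 2).add (kP.div kρ hne)).sub
      (kww.div kw hsq))).mono hsub).intervalIntegrable
  have hsub : ∀ s ∈ uIcc 0 t, s ∈ Icc 0 T := fun s hs => by
    rw [uIcc_of_le ht.1] at hs
    exact ⟨hs.1, hs.2.trans ht.2⟩
  rw [intervalIntegral.integral_congr fun s hs => hflux s (hsub s hs),
    intervalIntegral.integral_div, intervalIntegral.integral_sub ((hB 1 m1).add (hB 0 m0))
      (cL.intervalIntegrable 0 t), intervalIntegral.integral_add (hB 1 m1) (hB 0 m0),
    hmoment, hinit]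
  rw [hmass] at hI'
  refine hI'.hasDerivWithinAt.congr_deriv ?_
  ring
end

section
/- Let P : [0,∞) → ℝ be C¹ and let (ρ, u) be a classical solution of the 1D QHD system on [0,1]×[0,T] with initial data ρ(·,0) = ρ_I, u(·,0) = u_I, satisfying ρ_x(0,t) = ρ_x(1,t) = 0 for all t ∈ [0,T]. Then for every t ∈ [0,T]: ∫₀¹ x (ρu)(x,t) dx − ∫₀¹ x ρ_I u_I dx − ∫₀ᵗ ∫₀¹ (ρu² + P(ρ) + 2((√ρ)_x)²) dx ds = − ∫₀ᵗ ρ·(u² + P(ρ)/ρ − (√ρ)_xx/√ρ)(1,s) ds. -/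
open MeasureTheory Real Set

theorem contDiffOn_sqrt_comp {n : WithTop ℕ∞} {f : ℝ → ℝ} (hf : ContDiff ℝ n f) :
    ContDiffOn ℝ n (fun y => √(f y)) {y | 0 < f y} := fun _ hy =>
  (hf.contDiffAt.sqrt (ne_of_gt hy)).contDiffWithinAt

theorem deriv_sqrt_comp {f : ℝ → ℝ} (hf : Differentiable ℝ f) {x : ℝ} (hx : 0 < f x) :
    deriv (fun y => √(f y)) x = deriv f x / (2 * √(f x)) :=
  ((hf x).hasDerivAt.sqrt hx.ne').deriv

/-- The second derivative of `√f` where `f` is positive. -/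
theorem deriv_deriv_sqrt_comp {f : ℝ → ℝ} (hf : ContDiff ℝ 2 f) {x : ℝ} (hx : 0 < f x) :
    deriv (deriv fun y => √(f y)) x
      = deriv (deriv f) x / (2 * √(f x)) - deriv f x ^ 2 / (4 * (f x * √(f x))) := by
  have hd : Differentiable ℝ f := hf.differentiable (by norm_num)
  have hd' : Differentiable ℝ (deriv f) := hf.differentiable_deriv_two
  have hev : (deriv fun y => √(f y)) =ᶠ[nhds x] fun y => deriv f y / (2 * √(f y)) := by
    filter_upwards [hf.continuous.continuousAt.eventually (lt_mem_nhds hx)] with y hy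
    exact deriv_sqrt_comp hd hy
  have hs : 0 < √(f x) := Real.sqrt_pos.2 hx
  have hD := (hd' x).hasDerivAt.div (((hd x).hasDerivAt.sqrt hx.ne').const_mul 2)
    (by positivity : 2 * √(f x) ≠ 0)
  rw [hev.deriv_eq]
  refine hD.deriv.trans ?_
  have hsq : f x = √(f x) ^ 2 := (Real.sq_sqrt hx.le).symm
  set r := √(f x)
  rw [hsq]
  field_simp
  ring

/-- The flux whose derivative is `f v² + P(f) + 2 ((√f)')² - x m`, for `m` given by the stationary
form of the momentum equation. -/
theorem hasDerivAt_weighted_flux {P f v : ℝ → ℝ} {m x : ℝ}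
    (hP : ContDiffOn ℝ 1 P (Set.Ici 0)) (hf : ContDiff ℝ 3 f) (hv : ContDiff ℝ 2 v)
    (hx : 0 < f x)
    (hm : m + deriv (fun y => f y * v y ^ 2 + P (f y)) x
      = f x * deriv (fun y => deriv (deriv fun z => √(f z)) y / √(f y)) x) :
    HasDerivAt (fun y => y * (f y * v y ^ 2 + P (f y) - √(f y) * deriv (deriv fun z => √(f z)) y
        + deriv (fun z => √(f z)) y ^ 2) + √(f y) * deriv (fun z => √(f z)) y)
      (f x * v x ^ 2 + P (f x) + 2 * deriv (fun z => √(f z)) x ^ 2 - x * m) x := by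
  have hU : IsOpen {y | 0 < f y} := isOpen_lt continuous_const hf.continuous
  have hr : 0 < √(f x) := Real.sqrt_pos.2 hx
  have hsq : f x = √(f x) ^ 2 := (Real.sq_sqrt hx.le).symm
  have c0 := contDiffOn_sqrt_comp hf
  have c1 : ContDiffOn ℝ 2 (deriv fun z => √(f z)) {y | 0 < f y} :=
    c0.deriv_of_isOpen hU (by norm_num)
  have c2 : ContDiffOn ℝ 1 (deriv (deriv fun z => √(f z))) {y | 0 < f y} :=
    c1.deriv_of_isOpen hU (by norm_num)
  have hn : {y | 0 < f y} ∈ nhds x := hU.mem_nhds hx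
  have d0 := ((c0.contDiffAt hn).differentiableAt (by norm_num)).hasDerivAt
  have d1 := ((c1.contDiffAt hn).differentiableAt (by norm_num)).hasDerivAt
  have d2 := ((c2.contDiffAt hn).differentiableAt (by norm_num)).hasDerivAt
  have hPd : DifferentiableAt ℝ P (f x) :=
    (hP.contDiffAt (Ici_mem_nhds hx)).differentiableAt (by norm_num)
  have hfd : DifferentiableAt ℝ f x := hf.differentiable (by norm_num) x
  have hvd : DifferentiableAt ℝ v x := hv.differentiable (by norm_num) x
  have dw : HasDerivAt (fun y => f y * v y ^ 2 + P (f y))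
      (deriv (fun y => f y * v y ^ 2 + P (f y)) x) x :=
    ((hfd.mul (hvd.pow 2)).add (hPd.comp x hfd)).hasDerivAt
  rw [(d2.fun_div d0 hr.ne').deriv] at hm
  have := ((hasDerivAt_id x).mul ((dw.sub (d0.mul d2)).add (d1.pow 2))).add (d0.mul d1)
  refine this.congr_deriv ?_
  rw [eq_sub_of_add_eq hm]
  have e (a b : ℝ) : f x * ((a * √(f x) - b) / √(f x) ^ 2) = a * √(f x) - b := by
    rw [← hsq, mul_div_cancel₀ _ hx.ne']
  rw [e]
  simp only [id, Pi.add_apply, Pi.sub_apply, Pi.mul_apply, Pi.pow_apply]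
  ring

/-- Integrated form of the weighted momentum balance at a fixed time. -/
theorem integral_weighted_momentum {P f v m : ℝ → ℝ}
    (hP : ContDiffOn ℝ 1 P (Set.Ici 0)) (hf : ContDiff ℝ 3 f) (hv : ContDiff ℝ 2 v)
    (hm_cont : Continuous m) (hpos : ∀ x ∈ Set.Icc (0:ℝ) 1, 0 < f x)
    (h0 : deriv f 0 = 0) (h1 : deriv f 1 = 0)
    (hm : ∀ x ∈ Set.Icc (0:ℝ) 1, m x + deriv (fun y => f y * v y ^ 2 + P (f y)) x
      = f x * deriv (fun y => deriv (deriv fun z => √(f z)) y / √(f y)) x) :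
    (∫ x in (0:ℝ)..1, (f x * v x ^ 2 + P (f x) + 2 * deriv (fun z => √(f z)) x ^ 2))
      = (∫ x in (0:ℝ)..1, x * m x)
        + f 1 * (v 1 ^ 2 + P (f 1) / f 1 - deriv (deriv fun z => √(f z)) 1 / √(f 1)) := by
  have hd : Differentiable ℝ f := hf.differentiable (by norm_num)
  have hfc := hf.continuous
  have hvc := hv.continuous
  have hI : Set.uIcc (0:ℝ) 1 = Set.Icc 0 1 := Set.uIcc_of_le zero_le_one
  have hU : IsOpen {y | 0 < f y} := isOpen_lt continuous_const hfc
  have hPc : ContinuousOn (fun x => P (f x)) (Set.Icc 0 1) :=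
    hP.continuousOn.comp hfc.continuousOn fun x hx => (hpos x hx).le
  have hgc : ContinuousOn (deriv fun z => √(f z)) (Set.Icc 0 1) :=
    ((contDiffOn_sqrt_comp hf).deriv_of_isOpen (m := 2) hU (by norm_num)).continuousOn.mono hpos
  have hA : IntervalIntegrable
      (fun x => f x * v x ^ 2 + P (f x) + 2 * deriv (fun z => √(f z)) x ^ 2) volume 0 1 := by
    apply ContinuousOn.intervalIntegrable
    rw [hI]
    exact ((hfc.mul (hvc.pow 2)).continuousOn.add hPc).add (continuousOn_const.mul (hgc.pow 2))
  have hB : IntervalIntegrable (fun x => x * m x) volume 0 1 :=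
    (continuous_id.mul hm_cont).intervalIntegrable _ _
  have key := intervalIntegral.integral_eq_sub_of_hasDerivAt
    (fun x hx => hasDerivAt_weighted_flux hP hf hv (hpos x (hI ▸ hx)) (hm x (hI ▸ hx)))
    (hA.sub hB)
  rw [intervalIntegral.integral_sub hA hB] at key
  have p0 := hpos 0 (by simp)
  have p1 := hpos 1 (by simp)
  simp only [deriv_sqrt_comp hd p0, deriv_sqrt_comp hd p1, h0, h1] at key
  rw [sub_eq_iff_eq_add'] at key
  rw [key]
  have hr : 0 < √(f 1) := Real.sqrt_pos.2 p1
  have hsq : f 1 = √(f 1) ^ 2 := (Real.sq_sqrt p1.le).symm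
  have e1 : f 1 * (P (f 1) / f 1) = P (f 1) := by field_simp
  have e2 (a : ℝ) : f 1 * (a / √(f 1)) = √(f 1) * a := by
    rw [mul_div_assoc', div_eq_iff hr.ne']
    nth_rw 1 [hsq]
    ring
  rw [mul_sub, mul_add (f 1) (v 1 ^ 2), e1, e2]
  ring

/-- Integrating the time derivative of `h` against the weight `x`. -/
theorem integral_weighted_sub_eq_integral_integral {h k : ℝ → ℝ → ℝ} {t : ℝ}
    (hk : Continuous fun p : ℝ × ℝ => k p.1 p.2)
    (hh : Continuous fun p : ℝ × ℝ => h p.1 p.2)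
    (hderiv : ∀ x ∈ Set.Icc (0:ℝ) 1, ∀ s, HasDerivAt (h x) (k x s) s) :
    (∫ x in (0:ℝ)..1, x * h x t) - (∫ x in (0:ℝ)..1, x * h x 0)
      = ∫ s in (0:ℝ)..t, ∫ x in (0:ℝ)..1, x * k x s := by
  rw [← intervalIntegral_intervalIntegral_swap, ← intervalIntegral.integral_sub]
  · refine intervalIntegral.integral_congr fun x hx => ?_
    rw [Set.uIcc_of_le zero_le_one] at hx
    have hkx : Continuous (k x) := hk.comp (Continuous.prodMk_right x)
    simp only [intervalIntegral.integral_const_mul]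
    rw [intervalIntegral.integral_eq_sub_of_hasDerivAt (fun s _ => hderiv x hx s)
      (hkx.intervalIntegrable _ _)]
    ring
  · exact (continuous_id.mul (hh.comp (Continuous.prodMk_left t))).intervalIntegrable _ _
  · exact (continuous_id.mul (hh.comp (Continuous.prodMk_left 0))).intervalIntegrable _ _
  · have hc : Continuous (Function.uncurry fun x s : ℝ => x * k x s) := continuous_fst.mul hk
    exact (hc.continuousOn.integrableOn_compact (μ := volume)
      (isCompact_uIcc.prod isCompact_uIcc)).mono_set
      (Set.prod_mono Set.uIoc_subset_uIcc Set.uIoc_subset_uIcc)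

/-- Weighted (by `x`) integrated momentum balance for the 1D QHD system with Neumann
boundary conditions:
`∫₀¹ x(ρu)(t) − ∫₀¹ x ρ_I u_I − ∫₀ᵗ∫₀¹ (ρu² + P(ρ) + 2((√ρ)_x)²)
  = −∫₀ᵗ ρ(u² + P(ρ)/ρ − (√ρ)_xx/√ρ)(1,s) ds`. -/
theorem qhd1d_weighted_momentum
    (P : ℝ → ℝ) (hP : ContDiffOn ℝ 1 P (Set.Ici 0))
    (T : ℝ) (hT : 0 ≤ T) (ρ u : ℝ → ℝ → ℝ) (ρI uI : ℝ → ℝ)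
    (hsol : IsQHDSolution1D P ρ u T)
    (hρI : ∀ x ∈ Set.Icc (0:ℝ) 1, ρ x 0 = ρI x)
    (huI : ∀ x ∈ Set.Icc (0:ℝ) 1, u x 0 = uI x)
    (hNeumann : ∀ t ∈ Set.Icc (0:ℝ) T, pdx ρ 0 t = 0 ∧ pdx ρ 1 t = 0) :
    ∀ t ∈ Set.Icc (0:ℝ) T,
      (∫ x in (0:ℝ)..1, x * (ρ x t * u x t)) - (∫ x in (0:ℝ)..1, x * (ρI x * uI x))
        - (∫ s in (0:ℝ)..t, ∫ x in (0:ℝ)..1,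
            (ρ x s * u x s ^ 2 + P (ρ x s) + 2 * (pdx (sqf ρ) x s) ^ 2))
      = - ∫ s in (0:ℝ)..t,
            ρ 1 s * (u 1 s ^ 2 + P (ρ 1 s) / ρ 1 s - pdx (pdx (sqf ρ)) 1 s / sqf ρ 1 s) := by
  intro t ht
  have h01 : (1:ℝ) ∈ Set.Icc (0:ℝ) 1 := by simp
  have hsub : Set.uIcc 0 t ⊆ Set.Icc 0 T := by
    rw [Set.uIcc_of_le ht.1]
    exact Set.Icc_subset_Icc_right ht.2
  let k : ℝ → ℝ → ℝ := fun x s => pdt ρ x s * u x s + ρ x s * pdt u x s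
  have hk : Continuous fun p : ℝ × ℝ => k p.1 p.2 :=
    (hsol.rho_t_cont.mul hsol.u_cont).add (hsol.rho_cont.mul hsol.u_t_cont)
  have hderiv : ∀ x ∈ Set.Icc (0:ℝ) 1, ∀ s,
      HasDerivAt (fun s => ρ x s * u x s) (k x s) s := fun x hx s =>
    ((hsol.rho_C1_t x hx).differentiable (by norm_num) s).hasDerivAt.mul
      ((hsol.u_C1_t x hx).differentiable (by norm_num) s).hasDerivAt
  have hinit : (∫ x in (0:ℝ)..1, x * (ρI x * uI x)) = ∫ x in (0:ℝ)..1, x * (ρ x 0 * u x 0) := by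
    refine intervalIntegral.integral_congr fun x hx => ?_
    rw [Set.uIcc_of_le zero_le_one] at hx
    simp only [hρI x hx, huI x hx]
  have hspace : ∀ s ∈ Set.Icc 0 T,
      (∫ x in (0:ℝ)..1, (ρ x s * u x s ^ 2 + P (ρ x s) + 2 * (pdx (sqf ρ) x s) ^ 2))
      = (∫ x in (0:ℝ)..1, x * k x s)
        + ρ 1 s * (u 1 s ^ 2 + P (ρ 1 s) / ρ 1 s - pdx (pdx (sqf ρ)) 1 s / sqf ρ 1 s) :=
    fun s hs => integral_weighted_momentum hP (hsol.rho_C3_x s hs) (hsol.u_C2_x s hs)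
      (hk.comp (Continuous.prodMk_left s)) (fun x hx => hsol.pos x hx s hs)
      (hNeumann s hs).1 (hNeumann s hs).2 fun x hx => by
        have := hsol.momentum x hx s hs
        rw [show pdt (fun y s => ρ y s * u y s) x s = k x s from (hderiv x hx s).deriv] at this
        exact this
  have hbdry : ContinuousOn (fun s =>
      ρ 1 s * (u 1 s ^ 2 + P (ρ 1 s) / ρ 1 s - pdx (pdx (sqf ρ)) 1 s / sqf ρ 1 s))
      (Set.Icc 0 T) := by
    have hρ : Continuous (ρ 1) := hsol.rho_cont.comp (Continuous.prodMk_right 1)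
    have hu : Continuous (u 1) := hsol.u_cont.comp (Continuous.prodMk_right 1)
    have hρx : Continuous (pdx ρ 1) := hsol.rho_x_cont.comp (Continuous.prodMk_right 1)
    have hρxx : Continuous (pdx (pdx ρ) 1) := hsol.rho_xx_cont.comp (Continuous.prodMk_right 1)
    have hPc : ContinuousOn (fun s => P (ρ 1 s)) (Set.Icc 0 T) :=
      hP.continuousOn.comp hρ.continuousOn fun s hs => (hsol.pos 1 h01 s hs).le
    have hne : ∀ s ∈ Set.Icc 0 T, ρ 1 s ≠ 0 := fun s hs => (hsol.pos 1 h01 s hs).ne'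
    have hsne : ∀ s ∈ Set.Icc 0 T, √(ρ 1 s) ≠ 0 := fun s hs =>
      (Real.sqrt_pos.2 (hsol.pos 1 h01 s hs)).ne'
    have hs : ContinuousOn (fun s => √(ρ 1 s)) (Set.Icc 0 T) := hρ.sqrt.continuousOn
    have hxx : ContinuousOn (fun s => pdx (pdx (sqf ρ)) 1 s) (Set.Icc 0 T) := by
      have : ContinuousOn (fun s => pdx (pdx ρ) 1 s / (2 * √(ρ 1 s))
          - pdx ρ 1 s ^ 2 / (4 * (ρ 1 s * √(ρ 1 s)))) (Set.Icc 0 T) :=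
        (hρxx.continuousOn.div (continuousOn_const.mul hs)
          fun s hs => mul_ne_zero two_ne_zero (hsne s hs)).sub
        ((hρx.pow 2).continuousOn.div (continuousOn_const.mul (hρ.continuousOn.mul hs))
          fun s hs => mul_ne_zero four_ne_zero (mul_ne_zero (hne s hs) (hsne s hs)))
      exact this.congr fun s hs =>
        deriv_deriv_sqrt_comp ((hsol.rho_C3_x s hs).of_le (by norm_num)) (hsol.pos 1 h01 s hs)
    exact hρ.continuousOn.mul
      (((hu.pow 2).continuousOn.add (hPc.div hρ.continuousOn hne)).sub (hxx.div hs hsne))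
  have hC : Continuous fun s => ∫ x in (0:ℝ)..1, x * k x s :=
    intervalIntegral.continuous_parametric_intervalIntegral_of_continuous'
      (f := fun s x => x * k x s) (continuous_snd.mul (hk.comp continuous_swap)) 0 1
  rw [hinit, integral_weighted_sub_eq_integral_integral hk (hsol.rho_cont.mul hsol.u_cont) hderiv,
    intervalIntegral.integral_congr fun s hs => hspace s (hsub hs),
    intervalIntegral.integral_add (hC.intervalIntegrable _ _)
      (hbdry.mono hsub).intervalIntegrable]
  ring
end
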